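/- arXiv:2511.04558 — 11 statements merged into one kernel-verified Lean document; each statement's English description precedes it below -/
import Mathlib

section
/- Let α and β be nonnegative real numbers and let (p_j)_{j ∈ [N]} be a finite sequence of nonnegative real numbers with ∑_{j ∈ [N]} p_j ≤ 2β. Then ∑_{j ∈ [N]} min(β, p_j^{1+α}) ≤ 4 · β^{1 + α/(1+α)}. -/
/-- With `t = β ^ (1 / (1 + α))`, the truncated power `min β (x ^ (1 + α))` lies below the line of
slope `t ^ α` through the origin. -/
lemma min_rpow_one_add_le_mul {α β x : ℝ} (hα : 0 ≤ α) (hβ : 0 ≤ β) (hx : 0 ≤ x) :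
    min β (x ^ (1 + α)) ≤ x * β ^ (α / (1 + α)) := by
  have hγ : 1 + α ≠ 0 := by positivity
  set t := β ^ (1 / (1 + α)) with ht
  have ht0 : 0 ≤ t := Real.rpow_nonneg hβ _
  have htα : t ^ α = β ^ (α / (1 + α)) := by
    rw [ht, ← Real.rpow_mul hβ, one_div_mul_eq_div]
  have htβ : t * t ^ α = β := by
    rw [← Real.rpow_one_add' ht0 hγ, ht, ← Real.rpow_mul hβ, one_div_mul_cancel hγ,
      Real.rpow_one]
  rw [← htα]
  rcases le_total x t with h | h
  · refine (min_le_right _ _).trans ?_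
    rw [Real.rpow_one_add' hx hγ]
    gcongr
  · refine (min_le_left _ _).trans ?_
    calc β = t * t ^ α := htβ.symm
      _ ≤ x * t ^ α := by gcongr

/-- Smoothing Lemma: if `α, β ≥ 0` and `(p_j)` are nonnegative reals
with `∑ p_j ≤ 2β`, then `∑ min(β, p_j^{1+α}) ≤ 4 β^{1+α/(1+α)}`. -/
theorem stmt1 (α β : ℝ) (hα : 0 ≤ α) (hβ : 0 ≤ β) (N : ℕ) (p : Fin N → ℝ)
    (hp : ∀ j, 0 ≤ p j) (hsum : ∑ j, p j ≤ 2 * β) :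
    ∑ j, min β (p j ^ (1 + α)) ≤ 4 * β ^ (1 + α / (1 + α)) := by
  have hexp : 1 + α / (1 + α) ≠ 0 := by positivity
  have hpow : 0 ≤ β ^ (α / (1 + α)) := Real.rpow_nonneg hβ _
  calc ∑ j, min β (p j ^ (1 + α)) ≤ ∑ j, p j * β ^ (α / (1 + α)) :=
        Finset.sum_le_sum fun j _ => min_rpow_one_add_le_mul hα hβ (hp j)
    _ = (∑ j, p j) * β ^ (α / (1 + α)) := (Finset.sum_mul ..).symm
    _ ≤ 2 * β * β ^ (α / (1 + α)) := by gcongr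
    _ ≤ 4 * (β * β ^ (α / (1 + α))) := by nlinarith [mul_nonneg hβ hpow]
    _ = 4 * β ^ (1 + α / (1 + α)) := by rw [Real.rpow_one_add' hβ hexp]
end

section
/- Let M be a (2ℓ)-level multiplexer tree, let x ∈ {0,1}^n, let i ∈ [n] with x_i = 0, and let x^{\{i\}} denote x with the i-th bit flipped to 1. Then: (1) if Γ_M(x) = u for some leaf u ∈ [N]^{2ℓ}, then Γ_M(x^{\{i\}}) is either u or 1*; (2) if Γ_M(x) = 1*, then Γ_M(x^{\{i\}}) = 1*. -/
open scoped Classical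

/-- Result of the multiplexer map: a leaf of the tree (encoded as the list of
child indices from the leaf up to the root), or one of the special labels `0*`, `1*`. -/
inductive MuxResult (N : ℕ) : Type where
  | leaf : List (Fin N) → MuxResult N
  | zeroStar : MuxResult N
  | oneStar : MuxResult N

/-- A multiplexer tree labels the edge into each non-root node `v`
(a node at level `v.length`, encoded as the list of child indices from `v` up to the
root, most recent first) with a tuple in `[n]^s`.  The edge into `v` is *activated*
by `x` if the corresponding term (when `v` is at odd level) is satisfied by `x`,
resp. the corresponding clause (when `v` is at even level) is falsified by `x`. -/
def Activated {n s N : ℕ} (M : List (Fin N) → Fin s → Fin n)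
    (x : Fin n → Bool) (v : List (Fin N)) : Prop :=
  if v.length % 2 = 1 then ∀ k, x (M v k) = true else ∀ k, x (M v k) = false

/-- Descend along the unique activation path, with `fuel` levels remaining. -/
noncomputable def GammaAux {n s N : ℕ} (M : List (Fin N) → Fin s → Fin n)
    (x : Fin n → Bool) : ℕ → List (Fin N) → MuxResult N
  | 0, u => MuxResult.leaf u
  | fuel + 1, u =>
    if h : ∃! a : Fin N, Activated M x (a :: u) then
      GammaAux M x fuel (h.exists.choose :: u)
    else if ∀ a : Fin N, ¬ Activated M x (a :: u) then
      (if u.length % 2 = 0 then MuxResult.zeroStar else MuxResult.oneStar)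
    else
      (if u.length % 2 = 0 then MuxResult.oneStar else MuxResult.zeroStar)

/-- The multiplexer map `Γ_M` of a `(2ℓ)`-level multiplexer tree. -/
noncomputable def Gamma {n s N : ℕ} (ℓ : ℕ) (M : List (Fin N) → Fin s → Fin n)
    (x : Fin n → Bool) : MuxResult N :=
  GammaAux M x (2 * ℓ) []

section MultiplexerMonotone

variable {n s N : ℕ} {M : List (Fin N) → Fin s → Fin n} {x y : Fin n → Bool}
  {u v : List (Fin N)}

theorem Activated.mono_of_odd (hxy : x ≤ y) (hv : v.length % 2 = 1)
    (h : Activated M x v) : Activated M y v := by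
  simp only [Activated, hv, if_true] at h ⊢
  exact fun k => hxy (M v k) (h k)

theorem Activated.anti_of_even (hxy : x ≤ y) (hv : v.length % 2 = 0)
    (h : Activated M y v) : Activated M x v := by
  simp only [Activated, hv, zero_ne_one, if_false] at h ⊢
  exact fun k => Bool.eq_false_of_le_false ((hxy (M v k)).trans (h k).le)

theorem gammaAux_succ_of_unique {a : Fin N} (fuel : ℕ) (ha : Activated M x (a :: u))
    (huniq : ∀ b, Activated M x (b :: u) → b = a) :
    GammaAux M x (fuel + 1) u = GammaAux M x fuel (a :: u) := by
  have h : ∃! a : Fin N, Activated M x (a :: u) := ⟨a, ha, huniq⟩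
  rw [GammaAux, dif_pos h, huniq _ h.exists.choose_spec]

theorem gammaAux_succ_of_none (fuel : ℕ) (h : ∀ a, ¬ Activated M x (a :: u)) :
    GammaAux M x (fuel + 1) u =
      if u.length % 2 = 0 then MuxResult.zeroStar else MuxResult.oneStar := by
  rw [GammaAux, dif_neg fun ⟨a, ha, _⟩ => h a ha, if_pos h]

theorem gammaAux_succ_of_many (fuel : ℕ) (h : ¬ ∃! a, Activated M x (a :: u))
    (h' : ∃ a, Activated M x (a :: u)) :
    GammaAux M x (fuel + 1) u =
      if u.length % 2 = 0 then MuxResult.oneStar else MuxResult.zeroStar := by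
  rw [GammaAux, dif_neg h, if_neg fun hn => h'.elim hn]

/-- Increasing the input keeps a leaf value of the multiplexer map or turns it into `1*`,
and preserves the value `1*`. -/
theorem gammaAux_mono (hxy : x ≤ y) (fuel : ℕ) (u : List (Fin N)) :
    (∀ v, GammaAux M x fuel u = MuxResult.leaf v →
      GammaAux M y fuel u = MuxResult.leaf v ∨ GammaAux M y fuel u = MuxResult.oneStar) ∧
    (GammaAux M x fuel u = MuxResult.oneStar → GammaAux M y fuel u = MuxResult.oneStar) := by
  induction fuel generalizing u with
  | zero => simp [GammaAux]
  | succ fuel ih =>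
    rcases Nat.mod_two_eq_zero_or_one u.length with hu | hu
    · have up (b : Fin N) : Activated M x (b :: u) → Activated M y (b :: u) :=
        Activated.mono_of_odd hxy (by rw [List.length_cons]; omega)
      by_cases hex : ∃ a, Activated M x (a :: u)
      · obtain ⟨a, ha⟩ := hex
        by_cases huy : ∃! b, Activated M y (b :: u)
        · have hy (b) (hb : Activated M y (b :: u)) : b = a := huy.unique hb (up a ha)
          rw [gammaAux_succ_of_unique fuel ha fun b hb => hy b (up b hb),
            gammaAux_succ_of_unique fuel (up a ha) hy]
          exact ih (a :: u)
        · rw [gammaAux_succ_of_many (x := y) fuel huy ⟨a, up a ha⟩]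
          simp [hu]
      · rw [gammaAux_succ_of_none (x := x) fuel (not_exists.mp hex)]
        simp [hu]
    · have down (b : Fin N) : Activated M y (b :: u) → Activated M x (b :: u) :=
        Activated.anti_of_even hxy (by rw [List.length_cons]; omega)
      by_cases hex : ∃ a, Activated M y (a :: u)
      · obtain ⟨a, ha⟩ := hex
        by_cases hux : ∃! b, Activated M x (b :: u)
        · have hx (b) (hb : Activated M x (b :: u)) : b = a := hux.unique hb (down a ha)
          rw [gammaAux_succ_of_unique fuel (down a ha) hx,
            gammaAux_succ_of_unique fuel ha fun b hb => hx b (down b hb)]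
          exact ih (a :: u)
        · rw [gammaAux_succ_of_many (x := x) fuel hux ⟨a, down a ha⟩]
          simp [hu]
      · rw [gammaAux_succ_of_none (x := y) fuel (not_exists.mp hex)]
        simp [hu]

end MultiplexerMonotone

/-- if `x i = 0` then flipping bit `i` to `1` either keeps the value of
`Γ_M` at the same leaf or sends it to `1*`; and `Γ_M = 1*` is preserved. -/
theorem stmt2 (ℓ n s : ℕ) (hℓ : 1 ≤ ℓ) (hn : 1 ≤ n) (hs : s * s = n)
    (M : List (Fin (2 ^ s)) → Fin s → Fin n)
    (x : Fin n → Bool) (i : Fin n) (hx : x i = false) :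
    (∀ u : List (Fin (2 ^ s)), Gamma ℓ M x = MuxResult.leaf u →
        (Gamma ℓ M (Function.update x i true) = MuxResult.leaf u ∨
         Gamma ℓ M (Function.update x i true) = MuxResult.oneStar)) ∧
    (Gamma ℓ M x = MuxResult.oneStar →
        Gamma ℓ M (Function.update x i true) = MuxResult.oneStar) := by
  have hle : x ≤ Function.update x i true := le_update_iff.mpr ⟨le_top, fun _ _ => le_rfl⟩
  exact gammaAux_mono hle (2 * ℓ) []
end

section
/- Fix an integer constant ℓ ≥ 1. Draw a random (2ℓ)-level Talagrand function f = f_{M,H} as follows: the multiplexer tree M is drawn by choosing, independently and uniformly at random, the tuple in [n]^{√n} defining the term of each odd-level edge and the tuple in [n]^{√n} defining the clause of each even-level edge; independently, a secret variable s is drawn uniformly from [n], and for each leaf u of the tree, independently, h_u is set to the dictatorship function h_u(x) = x_s with probability 1/2 and to the anti-dictatorship function h_u(x) = 1 − x_s with probability 1/2. Then there exist constants ε > 0 and c > 0 depending only on ℓ, and an n₀ ∈ ℕ, such that for all n ≥ n₀ with √n an integer, with probability at least c over the draw of f, dist(f, monotone) ≥ ε. -/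
open scoped Classical
open Finset

def hwt {n : ℕ} (x : Fin n → Bool) : ℕ := (univ.filter fun i => x i = true).card

noncomputable def TalagrandFn {n s N : ℕ} (ℓ : ℕ) (M : List (Fin N) → Fin s → Fin n)
    (H : List (Fin N) → (Fin n → Bool) → Bool) (x : Fin n → Bool) : Bool :=
  if n + 2 * s < 2 * hwt x then true
  else if 2 * hwt x + 2 * s < n then false
  else
    match Gamma ℓ M x with
    | MuxResult.zeroStar => false
    | MuxResult.oneStar => true
    | MuxResult.leaf u => H u x

/-- Convert finitely-encoded edge labels (indexed by the level of a node together with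
its path from the root, padded to a function on `Fin (2ℓ)`) into a multiplexer tree.
The encoding is injective on the nodes of the `2ℓ`-level tree, so choosing the finite
data uniformly at random amounts to labelling every edge with an independent uniformly
random tuple in `[n]^s`. -/
def mtreeOf (ℓ n s : ℕ) (hn : 0 < n)
    (M' : Fin (2 * ℓ + 1) → (Fin (2 * ℓ) → Fin (2 ^ s)) → Fin s → Fin n) :
    List (Fin (2 ^ s)) → Fin s → Fin n :=
  fun v =>
    if hv : v.length ≤ 2 * ℓ then
      M' ⟨v.length, by omega⟩
        (fun i => if h : i.val < v.length then v.get ⟨i.val, h⟩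
                  else ⟨0, Nat.two_pow_pos s⟩)
    else fun _ => ⟨0, hn⟩

/-- The random leaf functions: for each leaf (a length-`2ℓ` path, encoded injectively
as a function on `Fin (2ℓ)`), an independent fair coin decides between the dictatorship
`x ↦ x_s` and the anti-dictatorship `x ↦ ¬ x_s` of the secret variable `sVar`. -/
def hOf (ℓ n s : ℕ) (sVar : Fin n)
    (coins : (Fin (2 * ℓ) → Fin (2 ^ s)) → Bool) :
    List (Fin (2 ^ s)) → (Fin n → Bool) → Bool :=
  fun v x =>
    if coins (fun i => if h : i.val < v.length then v.get ⟨i.val, h⟩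
                       else ⟨0, Nat.two_pow_pos s⟩)
    then x sVar else !(x sVar)

/-- The sample space for the `D_no` distribution: independent uniform labels for all
edges, a uniform secret variable, and independent fair coins for the leaves. -/
abbrev OmegaT (ℓ n s : ℕ) : Type :=
  (Fin (2 * ℓ + 1) → (Fin (2 * ℓ) → Fin (2 ^ s)) → Fin s → Fin n) ×
    Fin n × ((Fin (2 * ℓ) → Fin (2 ^ s)) → Bool)

/-- The node reached after following the first `j` choices of `a` from the root. -/
def pathNode {N : ℕ} (a : ℕ → Fin N) : ℕ → List (Fin N)
  | 0 => []
  | j + 1 => a j :: pathNode a j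

theorem length_pathNode {N : ℕ} (a : ℕ → Fin N) (j : ℕ) : (pathNode a j).length = j := by
  induction j with
  | zero => rfl
  | succ j ih => simp [pathNode, ih]

theorem pathNode_inj {N : ℕ} {a b : ℕ → Fin N} {j : ℕ} (h : pathNode a j = pathNode b j) :
    ∀ i < j, a i = b i := by
  induction j with
  | zero => simp
  | succ j ih =>
    simp only [pathNode, List.cons.injEq] at h
    intro i hi
    rcases Nat.lt_succ_iff_lt_or_eq.mp hi with hi | rfl
    · exact ih h.2 i hi
    · exact h.1

theorem gammaAux_eq_leaf {n s N : ℕ} (M : List (Fin N) → Fin s → Fin n) (x : Fin n → Bool)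
    (a : ℕ → Fin N) (m j : ℕ)
    (h : ∀ i < j + m, ∀ b, Activated M x (b :: pathNode a i) ↔ b = a i) :
    GammaAux M x m (pathNode a j) = MuxResult.leaf (pathNode a (j + m)) := by
  induction m generalizing j with
  | zero => rfl
  | succ m ih =>
    have hj := h j (by omega)
    have hu : ∃! b, Activated M x (b :: pathNode a j) :=
      ⟨a j, (hj _).2 rfl, fun b hb => (hj b).1 hb⟩
    have hc : hu.exists.choose = a j := (hj _).1 hu.exists.choose_spec
    have hstep := ih (j + 1) (fun i hi => h i (by omega))
    rw [GammaAux, dif_pos hu, hc]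
    rw [show j + (m + 1) = j + 1 + m by omega]
    exact hstep

/-- Coordinates of a uniformly random function are independent. -/
theorem card_filter_forall_mem {I J V : Type*} [Fintype I] [DecidableEq I] [Fintype J]
    [Fintype V] [DecidableEq V] [Nonempty V] (φ : J → I) (hφ : Function.Injective φ) (S : J → Finset V) :
    ((univ.filter fun f : I → V => ∀ j, f (φ j) ∈ S j).card : ℝ) =
      (∏ j, ((S j).card : ℝ) / Fintype.card V) * Fintype.card (I → V) := by
  have hV : (Fintype.card V : ℝ) ≠ 0 := by exact_mod_cast Fintype.card_ne_zero
  obtain ⟨A, hA, hA'⟩ : ∃ A : I → Finset V, (∀ j, A (φ j) = S j) ∧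
      ∀ i, (¬ ∃ j, φ j = i) → A i = univ :=
    ⟨Function.extend φ S fun _ => univ, hφ.extend_apply S _, fun i => Function.extend_apply' S _ i⟩
  have hset : (univ.filter fun f : I → V => ∀ j, f (φ j) ∈ S j) = Fintype.piFinset A := by
    ext f
    simp only [mem_filter, mem_univ, true_and, Fintype.mem_piFinset]
    constructor
    · intro h i
      by_cases hi : ∃ j, φ j = i
      · obtain ⟨j, rfl⟩ := hi
        rw [hA]
        exact h j
      · rw [hA' i hi]
        exact mem_univ _
    · intro h j
      rw [← hA]
      exact h _
  have hprod : (∏ j, ((S j).card : ℝ) / Fintype.card V) =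
      ∏ i, ((A i).card : ℝ) / Fintype.card V := by
    rw [← Finset.prod_subset (Finset.subset_univ (univ.image φ)),
      Finset.prod_image (fun _ _ _ _ h => hφ h)]
    · simp only [hA]
    · intro i _ hi
      have : ¬ ∃ j, φ j = i := by simpa using hi
      rw [hA' i this, Finset.card_univ, div_self hV]
  rw [hset, Fintype.card_piFinset, hprod, Finset.prod_div_distrib, Finset.prod_const,
    Fintype.card_fun, Finset.card_univ]
  push_cast
  field_simp

theorem exp_neg_two_mul_le {t : ℝ} (h0 : 0 ≤ t) (h1 : t ≤ 1 / 2) :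
    Real.exp (-(2 * t)) ≤ 1 - t := by
  rw [Real.exp_neg]
  have h2 := Real.add_one_le_exp (2 * t)
  refine (inv_anti₀ (by linarith) h2).trans ?_
  rw [inv_le_iff_one_le_mul₀ (by linarith)]
  nlinarith

theorem exp_neg_le_pow {t B : ℝ} (h0 : 0 ≤ t) (h1 : t ≤ 1 / 2) {m : ℕ} (hB : 2 * t * m ≤ B) :
    Real.exp (-B) ≤ (1 - t) ^ m := by
  calc Real.exp (-B) ≤ Real.exp (m * -(2 * t)) := Real.exp_le_exp.2 (by linarith)
    _ = Real.exp (-(2 * t)) ^ m := Real.exp_nat_mul _ _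
    _ ≤ (1 - t) ^ m := by
      gcongr
      exact exp_neg_two_mul_le h0 h1

/-- A random term or clause of width `s` is satisfied with probability `Ω(2⁻ˢ)` by a point
within `s` of the middle layer. -/
theorem exp_div_le_density_pow {n s m : ℕ} (hs : 4 ≤ s) (hn : s * s = n)
    (hm : n ≤ 2 * m + 2 * s) : Real.exp (-4) / 2 ^ s ≤ (m : ℝ) ^ s / (n : ℝ) ^ s := by
  have hs' : (4 : ℝ) ≤ s := by exact_mod_cast hs
  have hn' : (s : ℝ) * s = n := by exact_mod_cast hn
  have hm' : (n : ℝ) ≤ 2 * m + 2 * s := by exact_mod_cast hm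
  have h1 : Real.exp (-4) ≤ (1 - 2 / (s : ℝ)) ^ s := by
    apply exp_neg_le_pow (by positivity)
    · rw [div_le_div_iff₀] <;> linarith
    · field_simp
      norm_num
  rw [div_le_iff₀ (by positivity), ← div_pow, ← mul_pow]
  refine h1.trans ?_
  have h2 : (0 : ℝ) ≤ 1 - 2 / s := by
    rw [sub_nonneg, div_le_one] <;> linarith
  gcongr
  rw [← hn', div_mul_eq_mul_div, le_div_iff₀ (by positivity)]
  have : (1 - 2 / (s : ℝ)) * (s * s) = s * s - 2 * s := by field_simp
  linarith

/-- A random term or clause of width `s` is satisfied with probability `O(2⁻ˢ)` by a point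
within `s` of the middle layer. -/
theorem density_pow_le {n s m : ℕ} (hs : 4 ≤ s) (hn : s * s = n)
    (hm : 2 * m ≤ n + 2 * s) : (m : ℝ) ^ s / (n : ℝ) ^ s ≤ 8 / 2 ^ s := by
  have hs' : (4 : ℝ) ≤ s := by exact_mod_cast hs
  have hn' : (s : ℝ) * s = n := by exact_mod_cast hn
  have hm' : 2 * (m : ℝ) ≤ n + 2 * s := by exact_mod_cast hm
  rw [le_div_iff₀ (by positivity), ← div_pow, ← mul_pow]
  calc ((m : ℝ) / n * 2) ^ s ≤ (Real.exp (2 / s)) ^ s := by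
        gcongr
        refine le_trans ?_ (Real.add_one_le_exp _)
        rw [← hn', div_mul_eq_mul_div, div_le_iff₀ (by positivity)]
        have : (2 / (s : ℝ) + 1) * (s * s) = 2 * s + s * s := by field_simp
        linarith
    _ = Real.exp 1 ^ 2 := by
        rw [← Real.exp_nat_mul, ← Real.exp_nat_mul]
        congr 1
        field_simp
        norm_num
    _ ≤ 8 := by nlinarith [Real.exp_one_lt_d9, Real.exp_pos 1]

theorem sum_two_mul_hwt_sub_sq (n : ℕ) :
    ∑ x : Fin n → Bool, (2 * (hwt x : ℤ) - n) ^ 2 = (n : ℤ) * 2 ^ n := by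
  let σ : Bool → ℤ := fun b => if b then 1 else -1
  have hσ : ∀ x : Fin n → Bool, 2 * (hwt x : ℤ) - n = ∑ i, σ (x i) := by
    intro x
    have : ∀ i, σ (x i) = 2 * (if x i = true then 1 else 0) - 1 := by
      intro i
      cases x i <;> simp [σ]
    simp only [this, Finset.sum_sub_distrib, ← Finset.mul_sum, hwt, Finset.sum_boole]
    simp
  have horth : ∀ i j : Fin n, ∑ x : Fin n → Bool, σ (x i) * σ (x j) =
      if i = j then 2 ^ n else 0 := by
    intro i j
    split_ifs with h
    · subst h
      have : ∀ x : Fin n → Bool, σ (x i) * σ (x i) = 1 := by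
        intro x
        cases x i <;> simp [σ]
      simp [this]
    · refine Finset.sum_involution (fun x _ => Function.update x i (!x i)) ?_ ?_ ?_ ?_
      · intro x _
        simp only [Function.update_self, Function.update_of_ne (Ne.symm h)]
        cases x i <;> cases x j <;> simp [σ]
      · intro x _ _ hx
        have := congrFun hx i
        simp at this
      · simp
      · intro x _
        simp
  simp only [hσ, sq, Finset.sum_mul_sum]
  rw [Finset.sum_comm]
  simp_rw [Finset.sum_comm (s := (univ : Finset (Fin n → Bool))), horth]
  simp

/-- At least half of the cube lies in the middle layers, with one layer of slack on top. -/
theorem half_le_card_middle {n s : ℕ} (hs : 4 ≤ s) (hn : s * s = n) :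
    (2 : ℝ) ^ n / 2 ≤ (univ.filter fun x : Fin n → Bool =>
      n ≤ 2 * hwt x + 2 * s ∧ 2 * hwt x + 2 ≤ n + 2 * s).card := by
  set A := univ.filter fun x : Fin n → Bool =>
      n ≤ 2 * hwt x + 2 * s ∧ 2 * hwt x + 2 ≤ n + 2 * s with hA
  have hs' : (4 : ℤ) ≤ s := by exact_mod_cast hs
  have hn' : (s : ℤ) * s = n := by exact_mod_cast hn
  have hsum : (Aᶜ.card : ℤ) * (2 * s - 1) ^ 2 ≤ n * 2 ^ n := by
    rw [← sum_two_mul_hwt_sub_sq, ← nsmul_eq_mul]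
    refine (Finset.card_nsmul_le_sum Aᶜ (fun x => (2 * (hwt x : ℤ) - n) ^ 2) _ ?_).trans
      (Finset.sum_le_sum_of_subset_of_nonneg (Finset.subset_univ _)
        fun _ _ _ => sq_nonneg _)
    intro x hx
    simp only [hA, mem_compl, mem_filter, mem_univ, true_and] at hx
    have : (2 * s - 1 : ℤ) ≤ |2 * (hwt x : ℤ) - n| := by
      rw [le_abs]
      omega
    rw [← sq_abs (2 * (hwt x : ℤ) - n)]
    exact pow_le_pow_left₀ (by linarith) this 2
  have hcard : (A.card : ℤ) + Aᶜ.card = 2 ^ n := by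
    have := Finset.card_add_card_compl A
    simp only [Fintype.card_fun, Fintype.card_bool, Fintype.card_fin] at this
    exact_mod_cast this
  have hkey : (2 : ℤ) ^ n ≤ 2 * A.card := by
    have hc : (0 : ℤ) ≤ Aᶜ.card := by positivity
    have hsq : 2 * (n : ℤ) ≤ (2 * s - 1) ^ 2 := by nlinarith
    have h2 : (Aᶜ.card : ℤ) * (2 * n) ≤ n * 2 ^ n :=
      (mul_le_mul_of_nonneg_left hsq hc).trans hsum
    have hnpos : (0 : ℤ) < n := by nlinarith
    have : 2 * (Aᶜ.card : ℤ) ≤ 2 ^ n := by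
      refine le_of_mul_le_mul_left ?_ hnpos
      linarith
    linarith
  have : (2 : ℝ) ^ n ≤ 2 * A.card := by exact_mod_cast hkey
  linarith

theorem hwt_update_true {n : ℕ} {x : Fin n → Bool} {i : Fin n} (hi : x i = false) :
    hwt (Function.update x i true) = hwt x + 1 := by
  unfold hwt
  have : (univ.filter fun j => Function.update x i true j = true) =
      insert i (univ.filter fun j => x j = true) := by
    ext j
    by_cases h : j = i
    · simp [h]
    · simp [h]
  rw [this, Finset.card_insert_of_notMem (by simp [hi])]

theorem card_filter_eq_false {n : ℕ} (x : Fin n → Bool) :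
    (univ.filter fun i => x i = false).card + hwt x = n := by
  have := Finset.card_filter_add_card_filter_not (s := (univ : Finset (Fin n)))
    (fun i => x i = false)
  simpa [hwt] using this

theorem card_filter_forall_eq {n s : ℕ} (x : Fin n → Bool) (b : Bool) :
    (univ.filter fun t : Fin s → Fin n => ∀ k, x (t k) = b).card =
      (univ.filter fun i => x i = b).card ^ s := by
  have : (univ.filter fun t : Fin s → Fin n => ∀ k, x (t k) = b) =
      Fintype.piFinset fun _ => univ.filter fun i => x i = b := by
    ext t
    simp
  rw [this, Fintype.card_piFinset]
  simp

/-- The labels that put the edge `b` on (`b = a`) or off (`b ≠ a`) the unique activation path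
of both `x` and `y`, where `x ≤ y` and the edge leaves a node of level `j`. -/
noncomputable def jointLabels {n : ℕ} (s : ℕ) (x y : Fin n → Bool) (j : ℕ) (on : Prop) :
    Finset (Fin s → Fin n) :=
  univ.filter fun t =>
    if (j + 1) % 2 = 1 then
      if on then ∀ k, x (t k) = true else ¬ ∀ k, y (t k) = true
    else
      if on then ∀ k, y (t k) = false else ¬ ∀ k, x (t k) = false

theorem exp_le_density_jointLabels {n s : ℕ} (hs : 4 ≤ s) (hn : s * s = n)
    {x y : Fin n → Bool} (hy : hwt y = hwt x + 1) (hlo : n ≤ 2 * hwt x + 2 * s)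
    (hhi : 2 * hwt x + 2 ≤ n + 2 * s) (j : ℕ) :
    Real.exp (-4) / 2 ^ s ≤ ((jointLabels s x y j True).card : ℝ) / (n : ℝ) ^ s := by
  have h0 := card_filter_eq_false y
  unfold jointLabels
  split_ifs
  · rw [card_filter_forall_eq]
    push_cast
    exact exp_div_le_density_pow hs hn hlo
  · rw [card_filter_forall_eq]
    push_cast
    exact exp_div_le_density_pow hs hn (by omega)

theorem one_sub_le_density_jointLabels {n s : ℕ} (hs : 4 ≤ s) (hn : s * s = n)
    {x y : Fin n → Bool} (hy : hwt y = hwt x + 1) (hlo : n ≤ 2 * hwt x + 2 * s)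
    (hhi : 2 * hwt x + 2 ≤ n + 2 * s) (j : ℕ) :
    1 - 8 / 2 ^ s ≤ ((jointLabels s x y j False).card : ℝ) / (n : ℝ) ^ s := by
  have h0 := card_filter_eq_false x
  have hn0 : (0 : ℝ) < (n : ℝ) ^ s := by
    have : 0 < n := by nlinarith
    positivity
  have hcompl : ∀ (z : Fin n → Bool) (b : Bool),
      ((univ.filter fun t : Fin s → Fin n => ¬ ∀ k, z (t k) = b).card : ℝ) / (n : ℝ) ^ s =
        1 - ((univ.filter fun i => z i = b).card : ℝ) ^ s / (n : ℝ) ^ s := by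
    intro z b
    have h := Finset.card_filter_add_card_filter_not (s := (univ : Finset (Fin s → Fin n)))
      (fun t => ∀ k, z (t k) = b)
    rw [card_filter_forall_eq, Finset.card_univ, Fintype.card_fun, Fintype.card_fin,
      Fintype.card_fin] at h
    have h' : ((univ.filter fun i => z i = b).card : ℝ) ^ s +
        (univ.filter fun t : Fin s → Fin n => ¬ ∀ k, z (t k) = b).card = (n : ℝ) ^ s := by
      exact_mod_cast h
    field_simp
    linarith
  unfold jointLabels
  simp only [if_false]
  split_ifs
  · rw [hcompl]
    exact sub_le_sub_left (density_pow_le hs hn (m := hwt y) (by omega)) 1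
  · rw [hcompl]
    exact sub_le_sub_left (density_pow_le hs hn (by omega)) 1

/-- The encoding of a node as an index of the label table. -/
def padNode (ℓ s : ℕ) (v : List (Fin (2 ^ s))) : Fin (2 * ℓ) → Fin (2 ^ s) :=
  fun i => if h : i.val < v.length then v.get ⟨i.val, h⟩ else ⟨0, Nat.two_pow_pos s⟩

/-- The tables of edge labels of a random multiplexer tree. -/
abbrev LabelTable (ℓ n s : ℕ) : Type :=
  Fin (2 * ℓ + 1) → (Fin (2 * ℓ) → Fin (2 ^ s)) → Fin s → Fin n

/-- The extension by zero of a root-to-leaf path. -/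
def extendPath (ℓ s : ℕ) (a : Fin (2 * ℓ) → Fin (2 ^ s)) (j : ℕ) : Fin (2 ^ s) :=
  if h : j < 2 * ℓ then a ⟨j, h⟩ else ⟨0, Nat.two_pow_pos s⟩

/-- The index of the label of the edge `b` leaving the level-`j` node of the path `a`. -/
def edgeIndex (ℓ s : ℕ) (a : Fin (2 * ℓ) → Fin (2 ^ s)) (p : Fin (2 * ℓ) × Fin (2 ^ s)) :
    Fin (2 * ℓ + 1) × (Fin (2 * ℓ) → Fin (2 ^ s)) :=
  (p.1.succ, padNode ℓ s (p.2 :: pathNode (extendPath ℓ s a) p.1))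

theorem edgeIndex_injective {ℓ s : ℕ} (hℓ : 1 ≤ ℓ) (a : Fin (2 * ℓ) → Fin (2 ^ s)) :
    Function.Injective (edgeIndex ℓ s a) := by
  rintro ⟨j, b⟩ ⟨j', b'⟩ h
  simp only [edgeIndex, Prod.mk.injEq, Fin.succ_inj] at h
  have hb := congrFun h.2 ⟨0, by omega⟩
  simp only [padNode, List.length_cons, Nat.zero_lt_succ, dif_pos] at hb
  exact Prod.ext h.1 (by simpa using hb)

/-- The label tables for which `a` is the unique activation path of both `x` and `y`. -/
noncomputable def pathTables (ℓ : ℕ) {n : ℕ} (s : ℕ) (x y : Fin n → Bool)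
    (a : Fin (2 * ℓ) → Fin (2 ^ s)) : Finset (LabelTable ℓ n s) :=
  univ.filter fun M => ∀ p : Fin (2 * ℓ) × Fin (2 ^ s),
    M (edgeIndex ℓ s a p).1 (edgeIndex ℓ s a p).2 ∈ jointLabels s x y p.1 (p.2 = a p.1)

theorem card_pathTables_ge {ℓ n s : ℕ} (hℓ : 1 ≤ ℓ) (hs : 4 ≤ s) (hn : s * s = n)
    {x y : Fin n → Bool} (hy : hwt y = hwt x + 1) (hlo : n ≤ 2 * hwt x + 2 * s)
    (hhi : 2 * hwt x + 2 ≤ n + 2 * s) (a : Fin (2 * ℓ) → Fin (2 ^ s)) :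
    (Real.exp (-20) / 2 ^ s) ^ (2 * ℓ) * Fintype.card (LabelTable ℓ n s) ≤
      (pathTables ℓ s x y a).card := by
  have hn0 : 0 < n := by nlinarith
  have : Nonempty (Fin s → Fin n) := ⟨fun _ => ⟨0, hn0⟩⟩
  have hcurry : (pathTables ℓ s x y a).card =
      (univ.filter fun f : Fin (2 * ℓ + 1) × (Fin (2 * ℓ) → Fin (2 ^ s)) → Fin s → Fin n =>
        ∀ p : Fin (2 * ℓ) × Fin (2 ^ s),
          f (edgeIndex ℓ s a p) ∈ jointLabels s x y p.1 (p.2 = a p.1)).card := by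
    refine Finset.card_equiv (Equiv.curry _ _ _).symm fun M => ?_
    simp [pathTables, Function.uncurry]
  have htotal : Fintype.card (LabelTable ℓ n s) =
      Fintype.card (Fin (2 * ℓ + 1) × (Fin (2 * ℓ) → Fin (2 ^ s)) → Fin s → Fin n) :=
    Fintype.card_congr (Equiv.curry _ _ _).symm
  have hN : (16 : ℝ) ≤ 2 ^ s := by
    calc (16 : ℝ) = 2 ^ 4 := by norm_num
      _ ≤ 2 ^ s := pow_le_pow_right₀ (by norm_num) hs
  have hhalf : (8 : ℝ) / 2 ^ s ≤ 1 / 2 := by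
    rw [div_le_div_iff₀ (by positivity) (by norm_num)]
    linarith
  have hlevel : ∀ j : Fin (2 * ℓ), Real.exp (-20) / 2 ^ s ≤
      ∏ b : Fin (2 ^ s), ((jointLabels s x y j (b = a j)).card : ℝ) /
        Fintype.card (Fin s → Fin n) := by
    intro j
    rw [← Finset.mul_prod_erase _ _ (Finset.mem_univ (a j))]
    have hoff : ∀ b ∈ univ.erase (a j),
        1 - 8 / 2 ^ s ≤ ((jointLabels s x y j (b = a j)).card : ℝ) /
          Fintype.card (Fin s → Fin n) := by
      intro b hb
      have hne : (b = a j) = False := by simpa using hb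
      simpa [hne] using one_sub_le_density_jointLabels hs hn hy hlo hhi j
    have hon : Real.exp (-4) / 2 ^ s ≤
        ((jointLabels s x y j (a j = a j)).card : ℝ) / Fintype.card (Fin s → Fin n) := by
      simpa using exp_le_density_jointLabels hs hn hy hlo hhi j
    have hprod : Real.exp (-16) ≤ ∏ b ∈ univ.erase (a j),
        ((jointLabels s x y j (b = a j)).card : ℝ) / Fintype.card (Fin s → Fin n) := by
      refine le_trans ?_ (Finset.prod_le_prod (fun _ _ => by linarith) hoff)
      rw [Finset.prod_const]
      apply exp_neg_le_pow (by positivity) hhalf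
      rw [Finset.card_erase_of_mem (Finset.mem_univ _), Finset.card_univ, Fintype.card_fin]
      have : ((2 ^ s - 1 : ℕ) : ℝ) ≤ 2 ^ s := by
        exact_mod_cast Nat.sub_le _ _
      calc 2 * (8 / 2 ^ s) * ((2 ^ s - 1 : ℕ) : ℝ) ≤ 2 * (8 / 2 ^ s) * 2 ^ s := by gcongr
        _ = 16 := by
          field_simp
          norm_num
    calc Real.exp (-20) / 2 ^ s = Real.exp (-4) / 2 ^ s * Real.exp (-16) := by
          rw [div_mul_eq_mul_div, ← Real.exp_add]
          norm_num
      _ ≤ _ := by gcongr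
  rw [hcurry, htotal,
    card_filter_forall_mem (edgeIndex ℓ s a) (edgeIndex_injective hℓ a)
      (fun p => jointLabels s x y p.1 (p.2 = a p.1)), Fintype.prod_prod_type]
  gcongr
  calc (Real.exp (-20) / 2 ^ s) ^ (2 * ℓ) = ∏ _j : Fin (2 * ℓ), Real.exp (-20) / 2 ^ s := by
        rw [Finset.prod_const, Finset.card_univ, Fintype.card_fin]
    _ ≤ _ := Finset.prod_le_prod (fun _ _ => by positivity) fun j _ => hlevel j

theorem gamma_eq_of_mem_pathTables {ℓ n s : ℕ} (hn : 0 < n) {x y : Fin n → Bool}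
    (hxy : x ≤ y) {a : Fin (2 * ℓ) → Fin (2 ^ s)} {M : LabelTable ℓ n s}
    (hM : M ∈ pathTables ℓ s x y a) :
    Gamma ℓ (mtreeOf ℓ n s hn M) x = MuxResult.leaf (pathNode (extendPath ℓ s a) (2 * ℓ)) ∧
    Gamma ℓ (mtreeOf ℓ n s hn M) y =
      MuxResult.leaf (pathNode (extendPath ℓ s a) (2 * ℓ)) := by
  have htrue : ∀ i, x i = true → y i = true := fun i hi => by
    have := hxy i
    rw [hi] at this
    exact top_le_iff.mp this
  have hfalse : ∀ i, y i = false → x i = false := fun i hi => by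
    by_contra hx
    simp [htrue i (by simpa using hx)] at hi
  have key : ∀ i (hi : i < 2 * ℓ), ∀ b,
      (Activated (mtreeOf ℓ n s hn M) x (b :: pathNode (extendPath ℓ s a) i) ↔
        b = extendPath ℓ s a i) ∧
      (Activated (mtreeOf ℓ n s hn M) y (b :: pathNode (extendPath ℓ s a) i) ↔
        b = extendPath ℓ s a i) := by
    intro i hi b
    have hmem := (Finset.mem_filter.mp hM).2 (⟨i, hi⟩, b)
    have hlen : (b :: pathNode (extendPath ℓ s a) i).length = i + 1 := by
      simp [length_pathNode]
    have hext : extendPath ℓ s a i = a ⟨i, hi⟩ := dif_pos hi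
    have htree : mtreeOf ℓ n s hn M (b :: pathNode (extendPath ℓ s a) i) =
        M (edgeIndex ℓ s a (⟨i, hi⟩, b)).1 (edgeIndex ℓ s a (⟨i, hi⟩, b)).2 := by
      have hle : (b :: pathNode (extendPath ℓ s a) i).length ≤ 2 * ℓ := by omega
      have hfin : (⟨(b :: pathNode (extendPath ℓ s a) i).length, by omega⟩ :
          Fin (2 * ℓ + 1)) = Fin.succ ⟨i, hi⟩ := Fin.ext hlen
      simp only [mtreeOf, dif_pos hle, edgeIndex, hfin]
      rfl
    unfold Activated
    rw [hlen, htree, hext]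
    generalize M (edgeIndex ℓ s a (⟨i, hi⟩, b)).1 (edgeIndex ℓ s a (⟨i, hi⟩, b)).2 = t at hmem
    simp only [jointLabels, mem_filter, mem_univ, true_and] at hmem
    by_cases hpar : (i + 1) % 2 = 1 <;> by_cases hb : b = a ⟨i, hi⟩ <;>
      simp only [hpar, hb, if_true, if_false, iff_true, iff_false] at hmem ⊢
    · exact ⟨hmem, fun k => htrue _ (hmem k)⟩
    · exact ⟨fun h => hmem fun k => htrue _ (h k), hmem⟩
    · exact ⟨fun k => hfalse _ (hmem k), hmem⟩
    · exact ⟨hmem, fun h => hmem fun k => hfalse _ (h k)⟩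
  have hx := gammaAux_eq_leaf (mtreeOf ℓ n s hn M) x (extendPath ℓ s a) (2 * ℓ) 0
    fun i hi b => (key i (by omega) b).1
  have hy := gammaAux_eq_leaf (mtreeOf ℓ n s hn M) y (extendPath ℓ s a) (2 * ℓ) 0
    fun i hi b => (key i (by omega) b).2
  rw [zero_add] at hx hy
  exact ⟨hx, hy⟩

/-- The label tables sending both `x` and `y` to a common leaf have constant density. -/
theorem card_common_leaf_ge {ℓ n s : ℕ} (hℓ : 1 ≤ ℓ) (hs : 4 ≤ s) (hn : s * s = n)
    (hn0 : 0 < n) {x y : Fin n → Bool} (hxy : x ≤ y) (hy : hwt y = hwt x + 1)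
    (hlo : n ≤ 2 * hwt x + 2 * s) (hhi : 2 * hwt x + 2 ≤ n + 2 * s) :
    Real.exp (-20) ^ (2 * ℓ) * Fintype.card (LabelTable ℓ n s) ≤
      (univ.filter fun M : LabelTable ℓ n s => ∃ u,
        Gamma ℓ (mtreeOf ℓ n s hn0 M) x = MuxResult.leaf u ∧
        Gamma ℓ (mtreeOf ℓ n s hn0 M) y = MuxResult.leaf u).card := by
  have hsub : univ.biUnion (pathTables ℓ s x y) ⊆
      univ.filter fun M : LabelTable ℓ n s => ∃ u,
        Gamma ℓ (mtreeOf ℓ n s hn0 M) x = MuxResult.leaf u ∧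
        Gamma ℓ (mtreeOf ℓ n s hn0 M) y = MuxResult.leaf u := by
    intro M hM
    obtain ⟨a, -, ha⟩ := Finset.mem_biUnion.mp hM
    exact Finset.mem_filter.mpr ⟨Finset.mem_univ _, _, gamma_eq_of_mem_pathTables hn0 hxy ha⟩
  have hdisj : ∀ a ∈ (univ : Finset (Fin (2 * ℓ) → Fin (2 ^ s))), ∀ b ∈ univ, a ≠ b →
      Disjoint (pathTables ℓ s x y a) (pathTables ℓ s x y b) := by
    intro a _ b _ hab
    rw [Finset.disjoint_left]
    intro M ha hb
    apply hab
    have h := (gamma_eq_of_mem_pathTables hn0 hxy ha).1.symm.trans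
      (gamma_eq_of_mem_pathTables hn0 hxy hb).1
    have h' := pathNode_inj (MuxResult.leaf.inj h)
    funext i
    simpa [extendPath] using h' i i.2
  refine le_trans ?_ (Nat.cast_le.mpr (Finset.card_le_card hsub))
  rw [Finset.card_biUnion hdisj]
  push_cast
  calc Real.exp (-20) ^ (2 * ℓ) * (Fintype.card (LabelTable ℓ n s) : ℝ)
      = ∑ _a : Fin (2 * ℓ) → Fin (2 ^ s), (Real.exp (-20) / 2 ^ s) ^ (2 * ℓ) *
          (Fintype.card (LabelTable ℓ n s) : ℝ) := by
        have hc : Fintype.card (Fin (2 * ℓ) → Fin (2 ^ s)) = (2 ^ s) ^ (2 * ℓ) := by simp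
        rw [Finset.sum_const, Finset.card_univ, hc, nsmul_eq_mul]
        push_cast
        rw [← mul_assoc, ← mul_pow]
        congr 2
        field_simp
    _ ≤ _ := Finset.sum_le_sum fun a _ => card_pathTables_ge hℓ hs hn hy hlo hhi a

theorem two_mul_card_filter_apply_eq {C : Type*} [Fintype C] [DecidableEq C] (c : C) (b : Bool) :
    2 * (univ.filter fun f : C → Bool => f c = b).card = Fintype.card (C → Bool) := by
  have h := Finset.card_filter_add_card_filter_not (s := (univ : Finset (C → Bool)))
    (fun f => f c = b)
  have h2 : (univ.filter fun f : C → Bool => f c = b).card =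
      (univ.filter fun f : C → Bool => ¬ f c = b).card := by
    refine Finset.card_bij' (fun f _ => Function.update f c (!f c))
      (fun f _ => Function.update f c (!f c)) ?_ ?_ ?_ ?_
    · intro f hf
      simp_all
    · intro f hf
      simp only [mem_filter, mem_univ, true_and, Function.update_self] at hf ⊢
      cases hfc : f c <;> cases b <;> simp_all
    · intro f _
      simp
    · intro f _
      simp
  rw [Finset.card_univ] at h
  omega

/-- The lower endpoints of the edges of the cube in direction `i` on which `f` decreases. -/
def antiEdges {n : ℕ} (f : (Fin n → Bool) → Bool) (i : Fin n) : Finset (Fin n → Bool) :=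
  univ.filter fun x => x i = false ∧ f x = true ∧ f (Function.update x i true) = false

theorem card_antiEdges_le {n : ℕ} (f g : (Fin n → Bool) → Bool) (hg : Monotone g)
    (i : Fin n) : (antiEdges f i).card ≤ (univ.filter fun z => f z ≠ g z).card := by
  refine Finset.card_le_card_of_injOn
    (fun x => if f x ≠ g x then x else Function.update x i true) ?_ ?_
  · intro x hx
    simp only [antiEdges, coe_filter, mem_univ, true_and, Set.mem_ofPred_eq] at hx ⊢
    obtain ⟨hxi, hfx, hfy⟩ := hx
    split_ifs with h
    · exact h
    · have hle : x ≤ Function.update x i true := by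
        rw [le_update_iff]
        exact ⟨le_top, fun _ _ => le_rfl⟩
      have hgx : g x = true := by
        rw [not_not] at h
        rw [← h, hfx]
      have := hg hle
      rw [hgx] at this
      rw [hfy, top_le_iff.mp this]
      simp
  · intro x hx x' hx' h
    simp only [antiEdges, coe_filter, mem_univ, true_and, Set.mem_ofPred_eq] at hx hx' h
    have hback : ∀ z : Fin n → Bool, z i = false →
        Function.update (if f z ≠ g z then z else Function.update z i true) i false = z := by
      intro z hz
      split_ifs <;> simp [← hz]
    rw [← hback x hx.1, h, hback x' hx'.1]

/-- A reverse Markov inequality for averages over finite sets. -/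
theorem le_card_filter_of_le_sum {Ω : Type*} [Fintype Ω] (V : Ω → ℝ) {B δ : ℝ}
    (hB : 0 < B) (hδ : 0 ≤ δ) (hV : ∀ ω, V ω ≤ B)
    (hsum : 2 * δ * B * Fintype.card Ω ≤ ∑ ω, V ω) :
    δ * Fintype.card Ω ≤ (univ.filter fun ω => δ * B ≤ V ω).card := by
  have h : ∑ ω, V ω ≤ ∑ ω, ((if δ * B ≤ V ω then B else 0) + δ * B) := by
    refine Finset.sum_le_sum fun ω _ => ?_
    have := hV ω
    have : 0 ≤ δ * B := by positivity
    split_ifs <;> linarith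
  rw [Finset.sum_add_distrib, ← Finset.sum_filter, Finset.sum_const, Finset.sum_const,
    nsmul_eq_mul, nsmul_eq_mul, Finset.card_univ] at h
  refine le_of_mul_le_mul_right ?_ hB
  linarith

/-- For a fixed cube edge in the middle layers, the fraction of draws of labels and coins for
which the Talagrand function decreases along it is bounded below. -/
theorem card_anti_draws_ge {ℓ n s : ℕ} (hℓ : 1 ≤ ℓ) (hs : 4 ≤ s) (hn : s * s = n)
    (hn0 : 0 < n) {x : Fin n → Bool} {i : Fin n} (hi : x i = false)
    (hlo : n ≤ 2 * hwt x + 2 * s) (hhi : 2 * hwt x + 2 ≤ n + 2 * s) :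
    Real.exp (-20) ^ (2 * ℓ) / 2 * Fintype.card (LabelTable ℓ n s) *
        Fintype.card ((Fin (2 * ℓ) → Fin (2 ^ s)) → Bool) ≤
      (univ.filter fun q : LabelTable ℓ n s × ((Fin (2 * ℓ) → Fin (2 ^ s)) → Bool) =>
        x ∈ antiEdges (TalagrandFn ℓ (mtreeOf ℓ n s hn0 q.1) (hOf ℓ n s i q.2)) i).card := by
  set y := Function.update x i true with hydef
  have hy : hwt y = hwt x + 1 := hwt_update_true hi
  have hxy : x ≤ y := by
    rw [hydef, le_update_iff]
    exact ⟨le_top, fun _ _ => le_rfl⟩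
  have hcommon := card_common_leaf_ge hℓ hs hn hn0 hxy hy hlo hhi
  set G := univ.filter fun M : LabelTable ℓ n s => ∃ u,
        Gamma ℓ (mtreeOf ℓ n s hn0 M) x = MuxResult.leaf u ∧
        Gamma ℓ (mtreeOf ℓ n s hn0 M) y = MuxResult.leaf u with hG
  have hfib : ∀ M ∈ G, (Fintype.card ((Fin (2 * ℓ) → Fin (2 ^ s)) → Bool) : ℝ) / 2 ≤
      (univ.filter fun c : (Fin (2 * ℓ) → Fin (2 ^ s)) → Bool =>
        x ∈ antiEdges (TalagrandFn ℓ (mtreeOf ℓ n s hn0 M) (hOf ℓ n s i c)) i).card := by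
    intro M hM
    obtain ⟨u, hux, huy⟩ := (Finset.mem_filter.mp hM).2
    have hhalf := two_mul_card_filter_apply_eq (padNode ℓ s u) false
    have hle : (univ.filter fun c : (Fin (2 * ℓ) → Fin (2 ^ s)) → Bool =>
        c (padNode ℓ s u) = false).card ≤ (univ.filter fun c =>
        x ∈ antiEdges (TalagrandFn ℓ (mtreeOf ℓ n s hn0 M) (hOf ℓ n s i c)) i).card := by
      refine Finset.card_le_card fun c hc => ?_
      simp only [mem_filter, mem_univ, true_and] at hc
      have hleaf : ∀ z : Fin n → Bool, hOf ℓ n s i c u z = !(z i) := by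
        intro z
        have : hOf ℓ n s i c u z = if c (padNode ℓ s u) then z i else !(z i) := rfl
        rw [this, hc]
        simp
      simp only [antiEdges, mem_filter, mem_univ, true_and]
      refine ⟨hi, ?_, ?_⟩
      · unfold TalagrandFn
        rw [if_neg (by omega), if_neg (by omega), hux]
        simp [hleaf, hi]
      · rw [← hydef]
        unfold TalagrandFn
        rw [if_neg (by omega), if_neg (by omega), huy]
        simp [hleaf, hydef]
    rw [div_le_iff₀ (by norm_num), ← hhalf]
    push_cast
    have : ((univ.filter fun c : (Fin (2 * ℓ) → Fin (2 ^ s)) → Bool =>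
        c (padNode ℓ s u) = false).card : ℝ) ≤ _ := Nat.cast_le.mpr hle
    linarith
  rw [Finset.card_filter, Fintype.sum_prod_type]
  simp only [← Finset.card_filter]
  push_cast
  calc Real.exp (-20) ^ (2 * ℓ) / 2 * (Fintype.card (LabelTable ℓ n s) : ℝ) *
        Fintype.card ((Fin (2 * ℓ) → Fin (2 ^ s)) → Bool)
      = (Real.exp (-20) ^ (2 * ℓ) * (Fintype.card (LabelTable ℓ n s) : ℝ)) *
        (Fintype.card ((Fin (2 * ℓ) → Fin (2 ^ s)) → Bool) / 2) := by ring
    _ ≤ G.card * (Fintype.card ((Fin (2 * ℓ) → Fin (2 ^ s)) → Bool) / 2) := by gcongr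
    _ ≤ ∑ M ∈ G, ((univ.filter fun c : (Fin (2 * ℓ) → Fin (2 ^ s)) → Bool =>
        x ∈ antiEdges (TalagrandFn ℓ (mtreeOf ℓ n s hn0 M) (hOf ℓ n s i c)) i).card : ℝ) := by
      rw [← nsmul_eq_mul]
      exact Finset.card_nsmul_le_sum _ _ _ hfib
    _ ≤ _ := Finset.sum_le_sum_of_subset_of_nonneg (Finset.subset_univ _)
        fun _ _ _ => by positivity

/-- The expected number of decreasing edges in the secret direction is a constant fraction of
the cube. -/
theorem sum_card_antiEdges_ge {ℓ n s : ℕ} (hℓ : 1 ≤ ℓ) (hs : 4 ≤ s) (hn : s * s = n)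
    (hn0 : 0 < n) :
    Real.exp (-20) ^ (2 * ℓ) / 16 * 2 ^ n * Fintype.card (OmegaT ℓ n s) ≤
      ∑ ω : OmegaT ℓ n s, ((antiEdges
        (TalagrandFn ℓ (mtreeOf ℓ n s hn0 ω.1) (hOf ℓ n s ω.2.1 ω.2.2)) ω.2.1).card : ℝ) := by
  set K : ℝ := Real.exp (-20) ^ (2 * ℓ) / 2 * Fintype.card (LabelTable ℓ n s) *
        Fintype.card ((Fin (2 * ℓ) → Fin (2 ^ s)) → Bool) with hK
  have hK0 : 0 ≤ K := by positivity
  set D : (Fin n → Bool) → Fin n → ℝ := fun x i =>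
      ((univ.filter fun q : LabelTable ℓ n s × ((Fin (2 * ℓ) → Fin (2 ^ s)) → Bool) =>
        x ∈ antiEdges (TalagrandFn ℓ (mtreeOf ℓ n s hn0 q.1) (hOf ℓ n s i q.2)) i).card : ℝ)
    with hD
  have hswap : ∑ ω : OmegaT ℓ n s, ((antiEdges
        (TalagrandFn ℓ (mtreeOf ℓ n s hn0 ω.1) (hOf ℓ n s ω.2.1 ω.2.2)) ω.2.1).card : ℝ) =
      ∑ x, ∑ i, D x i := by
    have hcard : ∀ A : Finset (Fin n → Bool), (A.card : ℝ) = ∑ x, if x ∈ A then 1 else 0 := by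
      intro A
      simp
    simp only [hD, Finset.card_filter, hcard, Nat.cast_sum, Nat.cast_ite, Nat.cast_one,
      Nat.cast_zero, Fintype.sum_prod_type]
    refine Finset.sum_comm.trans ((Finset.sum_congr rfl fun i _ => ?_).trans Finset.sum_comm)
    refine (Finset.sum_congr rfl fun M _ => ?_).trans Finset.sum_comm
    exact Finset.sum_comm
  rw [hswap]
  have hpoint : ∀ x ∈ univ.filter (fun x : Fin n → Bool =>
      n ≤ 2 * hwt x + 2 * s ∧ 2 * hwt x + 2 ≤ n + 2 * s), (n : ℝ) / 4 * K ≤ ∑ i, D x i := by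
    intro x hx
    obtain ⟨hlo, hhi⟩ := (Finset.mem_filter.mp hx).2
    have hcount : (n : ℝ) / 4 ≤ (univ.filter fun i => x i = false).card := by
      have h0 := card_filter_eq_false x
      have : n ≤ 4 * (univ.filter fun i => x i = false).card := by nlinarith
      have : (n : ℝ) ≤ 4 * (univ.filter fun i => x i = false).card := by exact_mod_cast this
      linarith
    calc (n : ℝ) / 4 * K ≤ (univ.filter fun i => x i = false).card * K := by gcongr
      _ ≤ ∑ i ∈ univ.filter fun i => x i = false, D x i := by
        rw [← nsmul_eq_mul]
        exact Finset.card_nsmul_le_sum _ _ _ fun i hi =>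
          card_anti_draws_ge hℓ hs hn hn0 (Finset.mem_filter.mp hi).2 hlo hhi
      _ ≤ _ := Finset.sum_le_sum_of_subset_of_nonneg (Finset.subset_univ _)
        fun _ _ _ => by positivity
  have hΩ : (Fintype.card (OmegaT ℓ n s) : ℝ) = Fintype.card (LabelTable ℓ n s) *
      (n * Fintype.card ((Fin (2 * ℓ) → Fin (2 ^ s)) → Bool)) := by
    rw [Fintype.card_prod, Fintype.card_prod, Fintype.card_fin]
    push_cast
    rfl
  calc Real.exp (-20) ^ (2 * ℓ) / 16 * 2 ^ n * (Fintype.card (OmegaT ℓ n s) : ℝ)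
      = 2 ^ n / 2 * (n / 4 * K) := by
        rw [hΩ, hK]
        ring
    _ ≤ _ * (n / 4 * K) :=
        mul_le_mul_of_nonneg_right (half_le_card_middle hs hn) (by positivity)
    _ ≤ ∑ x ∈ univ.filter (fun x : Fin n → Bool =>
        n ≤ 2 * hwt x + 2 * s ∧ 2 * hwt x + 2 ≤ n + 2 * s), ∑ i, D x i := by
        rw [← nsmul_eq_mul]
        exact Finset.card_nsmul_le_sum _ _ _ hpoint
    _ ≤ _ := Finset.sum_le_sum_of_subset_of_nonneg (Finset.subset_univ _)
        fun _ _ _ => Finset.sum_nonneg fun _ _ => by positivity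

/-- for the random `(2ℓ)`-level Talagrand function drawn as in `D_no`
(uniform random terms/clauses, a uniform secret variable `s`, and an independent fair
coin per leaf choosing dictatorship/anti-dictatorship of `s`), there are constants
`ε, c > 0` (depending only on `ℓ`) such that for all large `n` with `√n ∈ ℕ`, with
probability at least `c` the function is `ε`-far from every monotone function. -/
theorem stmt4 (ℓ : ℕ) (hℓ : 1 ≤ ℓ) :
    ∃ ε : ℝ, 0 < ε ∧ ∃ c : ℝ, 0 < c ∧ ∃ n₀ : ℕ, ∀ n : ℕ, n₀ ≤ n → ∀ s : ℕ, s * s = n →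
    ∀ hn : 0 < n,
      c ≤ ((Finset.univ.filter (fun ω : OmegaT ℓ n s =>
            ∀ g : (Fin n → Bool) → Bool, Monotone g →
              ε ≤ ((Finset.univ.filter (fun z : Fin n → Bool =>
                      TalagrandFn ℓ (mtreeOf ℓ n s hn ω.1) (hOf ℓ n s ω.2.1 ω.2.2) z
                        ≠ g z)).card : ℝ) / 2 ^ n)).card : ℝ) /
          (Fintype.card (OmegaT ℓ n s) : ℝ) := by
  refine ⟨Real.exp (-20) ^ (2 * ℓ) / 32, by positivity, Real.exp (-20) ^ (2 * ℓ) / 32,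
    by positivity, 16, fun n hn₀ s hs hn => ?_⟩
  have hs4 : 4 ≤ s := by
    by_contra h
    have : s ≤ 3 := by omega
    nlinarith
  have : Nonempty (OmegaT ℓ n s) := ⟨(fun _ _ _ => ⟨0, hn⟩, ⟨0, hn⟩, fun _ => true)⟩
  have hsum := sum_card_antiEdges_ge hℓ hs4 hs hn
  have hmarkov := le_card_filter_of_le_sum (Ω := OmegaT ℓ n s)
    (fun ω => ((antiEdges
      (TalagrandFn ℓ (mtreeOf ℓ n s hn ω.1) (hOf ℓ n s ω.2.1 ω.2.2)) ω.2.1).card : ℝ))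
    (B := 2 ^ n) (δ := Real.exp (-20) ^ (2 * ℓ) / 32) (by positivity) (by positivity)
    (fun ω => by
      have := Finset.card_le_univ (antiEdges
        (TalagrandFn ℓ (mtreeOf ℓ n s hn ω.1) (hOf ℓ n s ω.2.1 ω.2.2)) ω.2.1)
      simp only [Fintype.card_fun, Fintype.card_bool, Fintype.card_fin] at this
      exact_mod_cast this)
    (by linarith)
  rw [le_div_iff₀ (by exact_mod_cast Fintype.card_pos)]
  refine hmarkov.trans (Nat.cast_le.mpr (Finset.card_le_card fun ω hω => ?_))
  simp only [mem_filter, mem_univ, true_and] at hω ⊢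
  intro g hg
  rw [le_div_iff₀ (by positivity)]
  exact hω.trans (Nat.cast_le.mpr (card_antiEdges_le _ g hg _))
end

section
/- Let n ≥ 2 be an integer with √n an integer, and let P ⊆ P' be two nonempty finite sets of points of {0,1}^n lying in the middle layers. Assume |A_{P',1}| ≥ n/2 − 100√n(log₂ n)|P'| and |A_{P,0}| ≥ n/2 − 100√n(log₂ n)|P|. Then |A_{P,1}| ≥ n/2 − 150√n(log₂ n) · min(|P|², |P'|). -/
open Finset

/-- `x` lies in the middle layers: `n/2 - √n ≤ |x| ≤ n/2 + √n` (with `s = √n`). -/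
def MiddleLayers (n s : ℕ) (x : Fin n → Bool) : Prop :=
  n ≤ 2 * hwt x + 2 * s ∧ 2 * hwt x ≤ n + 2 * s

/-- `A_{S,b}`: the coordinates on which all points of `S` are equal to `b`. -/
def Aset {n : ℕ} (S : Finset (Fin n → Bool)) (b : Bool) : Finset (Fin n) :=
  univ.filter fun i => ∀ x ∈ S, x i = b

theorem Aset_anti {n : ℕ} {S T : Finset (Fin n → Bool)} (h : S ⊆ T) (b : Bool) :
    Aset T b ⊆ Aset S b := by
  intro i hi
  simp only [Aset, mem_filter, mem_univ, true_and] at hi ⊢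
  exact fun x hx => hi x (h hx)

theorem card_Aset_true_add_ge {n : ℕ} (S : Finset (Fin n → Bool)) :
    n + S.card * (Aset S false).card ≤
      (Aset S true).card + (Aset S false).card + ∑ x ∈ S, (n - hwt x) := by
  have hcard : ∀ x ∈ S,
      ((univ.filter fun i => x i = false) \ Aset S false).card + (Aset S false).card
        = n - hwt x := by
    intro x hx
    rw [card_sdiff_add_card_eq_card]
    · have h := card_filter_add_card_filter_not (s := (univ : Finset (Fin n))) (fun i => x i = true)
      simp only [Bool.not_eq_true, card_univ, Fintype.card_fin] at h
      unfold hwt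
      omega
    · intro i hi
      simp only [Aset, mem_filter, mem_univ, true_and] at hi ⊢
      exact hi x hx
  have hcover : (univ : Finset (Fin n)) ⊆ (Aset S true ∪ Aset S false) ∪
      S.biUnion fun x => (univ.filter fun i => x i = false) \ Aset S false := by
    intro i _
    by_cases h0 : i ∈ Aset S false
    · simp [h0]
    by_cases h1 : i ∈ Aset S true
    · simp [h1]
    have h2 : ∃ x ∈ S, x i = false := by simpa [Aset] using h1
    simpa [h0, h1] using h2
  have hle := (card_le_card hcover).trans
    ((card_union_le _ _).trans (add_le_add (card_union_le _ _) card_biUnion_le))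
  rw [card_univ, Fintype.card_fin] at hle
  rw [← sum_congr rfl hcard, sum_add_distrib, sum_const, smul_eq_mul]
  omega

theorem sub_hwt_le_of_middleLayers {n s : ℕ} {x : Fin n → Bool} (h : MiddleLayers n s x) :
    ((n - hwt x : ℕ) : ℝ) ≤ n / 2 + s := by
  have h2 : 2 * (n - hwt x) ≤ n + 2 * s := by
    have := h.1
    omega
  have h3 : (2 : ℝ) * ((n - hwt x : ℕ) : ℝ) ≤ n + 2 * s := by exact_mod_cast h2
  linarith

theorem stmt5 (n s : ℕ) (hn : 2 ≤ n) (hs : s * s = n)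
    (P P' : Finset (Fin n → Bool)) (hPne : P.Nonempty) (hP'ne : P'.Nonempty)
    (hsub : P ⊆ P') (hmid : ∀ x ∈ P', MiddleLayers n s x)
    (h1 : (n : ℝ) / 2 - 100 * s * Real.logb 2 n * P'.card ≤ ((Aset P' true).card : ℝ))
    (h0 : (n : ℝ) / 2 - 100 * s * Real.logb 2 n * P.card ≤ ((Aset P false).card : ℝ)) :
    (n : ℝ) / 2 - 150 * s * Real.logb 2 n * min ((P.card : ℝ) ^ 2) (P'.card : ℝ)
      ≤ ((Aset P true).card : ℝ) := by
  have hL : 1 ≤ Real.logb 2 n := by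
    rw [Real.le_logb_iff_rpow_le one_lt_two (by positivity), Real.rpow_one]
    exact_mod_cast hn
  rcases le_total ((P.card : ℝ) ^ 2) (P'.card : ℝ) with h | h
  · rw [min_eq_left h]
    have hp : (1 : ℝ) ≤ P.card := by exact_mod_cast hPne.card_pos
    have hsum : ((∑ x ∈ P, (n - hwt x) : ℕ) : ℝ) ≤ P.card * ((n : ℝ) / 2 + s) := by
      rw [Nat.cast_sum, ← nsmul_eq_mul]
      exact sum_le_card_nsmul _ _ _ fun x hx => sub_hwt_le_of_middleLayers (hmid x (hsub hx))
    have hcard : (n : ℝ) + P.card * (Aset P false).card ≤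
        (Aset P true).card + (Aset P false).card + (∑ x ∈ P, (n - hwt x) : ℕ) := by
      exact_mod_cast card_Aset_true_add_ge P
    have hzero := mul_le_mul_of_nonneg_left h0 (sub_nonneg.2 hp)
    have hsL : (s : ℝ) ≤ s * Real.logb 2 n := le_mul_of_one_le_right (Nat.cast_nonneg s) hL
    have hpsL := mul_le_mul_of_nonneg_left hsL (zero_le_one.trans hp)
    have hsL0 : 0 ≤ s * Real.logb 2 n * (P.card : ℝ) ^ 2 := by positivity
    have hsLp : 0 ≤ s * Real.logb 2 n * (P.card : ℝ) := by positivity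
    linarith
  · rw [min_eq_right h]
    have hmono : ((Aset P' true).card : ℝ) ≤ (Aset P true).card := by
      exact_mod_cast card_le_card (Aset_anti hsub true)
    have hsL0 : 0 ≤ s * Real.logb 2 n * (P'.card : ℝ) := by positivity
    linarith
end

section
/- In the tree setting with nesting (i) and goodness (iii), for every node u at level k with 2 ≤ k ≤ 2ℓ whose parent is v, one has |B_u| ≤ 250√n(log₂ n) · |P_v|. -/
open scoped Classical
open Finset

/-- Nodes of the complete `N`-ary tree of depth `2ℓ` are encoded as lists over
`Fin N` of length at most `2ℓ` (the list of child indices from the node up to the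
root, most recent first; the root is `[]` and the children of `u` are `a :: u`).
`Bset ℓ P u` is the union, over the leaves `w ++ u` of the subtree rooted at `u`,
of the dangerous sets `D_{w++u} = {i : ∃ x y ∈ P_{w++u}, x i ≠ y i}`. -/
noncomputable def Bset (ℓ : ℕ) {n N : ℕ} (P : List (Fin N) → Finset (Fin n → Bool))
    (u : List (Fin N)) : Finset (Fin n) :=
  univ.filter fun i => ∃ w : List (Fin N), w.length + u.length = 2 * ℓ ∧
    ∃ x ∈ P (w ++ u), ∃ y ∈ P (w ++ u), x i ≠ y i

/-- Repeated nesting: the set at a descendant is contained in the set at the ancestor. -/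
theorem subset_of_append {α β : Type*} (L : ℕ) (P : List α → Finset β)
    (hnest : ∀ u : List α, 1 ≤ u.length → u.length ≤ L - 1 → ∀ a : α, P (a :: u) ⊆ P u)
    (u : List α) (hu : 1 ≤ u.length) (w : List α) (hw : w.length + u.length ≤ L) :
    P (w ++ u) ⊆ P u := by
  induction w with
  | nil => simp
  | cons a w ih =>
    simp only [List.length_cons] at hw
    refine (hnest (w ++ u) ?_ ?_ a).trans (ih (by omega))
    · rw [List.length_append]; omega
    · rw [List.length_append]; omega

/-- For nonempty `S ⊆ T`, the coordinates on which `S` is constantly `b`, those on which `T` is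
constantly `b' ≠ b`, and a set of coordinates on which `S` is not constant are pairwise disjoint. -/
theorem card_add_card_Aset_le {n : ℕ} {S T : Finset (Fin n → Bool)} (hST : S ⊆ T)
    (hS : S.Nonempty) {b b' : Bool} (hb : b ≠ b') (B : Finset (Fin n))
    (hB : ∀ i ∈ B, ∃ x ∈ S, ∃ y ∈ S, x i ≠ y i) :
    B.card + ((Aset S b).card + (Aset T b').card) ≤ n := by
  have hdisj : Disjoint (Aset S b) (Aset T b') := by
    rw [Finset.disjoint_left]
    intro i hi hi'
    obtain ⟨x, hx⟩ := hS
    simp only [Aset, mem_filter, mem_univ, true_and] at hi hi'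
    exact hb ((hi x hx).symm.trans (hi' x (hST hx)))
  have hdisjB : Disjoint B (Aset S b ∪ Aset T b') := by
    rw [Finset.disjoint_left]
    intro i hi hi'
    obtain ⟨x, hx, y, hy, hxy⟩ := hB i hi
    simp only [Aset, mem_union, mem_filter, mem_univ, true_and] at hi'
    rcases hi' with h | h
    · exact hxy ((h x hx).trans (h y hy).symm)
    · exact hxy ((h x (hST hx)).trans (h y (hST hy)).symm)
  rw [← card_union_of_disjoint hdisj, ← card_union_of_disjoint hdisjB]
  exact card_le_univ _ |>.trans_eq (Fintype.card_fin n)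

/-- with nesting (i) and goodness (iii), every node `u` at level
`2 ≤ k ≤ 2ℓ` with parent `v = u.tail` satisfies `|B_u| ≤ 250 √n (log₂ n) |P_v|`. -/
theorem stmt7 (ℓ n s : ℕ) (hℓ : 1 ≤ ℓ) (hn : 2 ≤ n) (hs : s * s = n)
    (N : ℕ) (hN : N = 2 ^ s)
    (P : List (Fin N) → Finset (Fin n → Bool))
    (hmid : ∀ u : List (Fin N), 1 ≤ u.length → u.length ≤ 2 * ℓ →
      ∀ x ∈ P u, MiddleLayers n s x)
    (hnest : ∀ u : List (Fin N), 1 ≤ u.length → u.length ≤ 2 * ℓ - 1 →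
      ∀ a : Fin N, P (a :: u) ⊆ P u)
    (hgood1 : ∀ u : List (Fin N), u.length % 2 = 1 → u.length ≤ 2 * ℓ →
      (P u).Nonempty →
      (n : ℝ) / 2 - 100 * s * Real.logb 2 n * (P u).card ≤ ((Aset (P u) true).card : ℝ))
    (hgood0 : ∀ u : List (Fin N), u.length % 2 = 0 → 1 ≤ u.length → u.length ≤ 2 * ℓ →
      (P u).Nonempty →
      (n : ℝ) / 2 - 100 * s * Real.logb 2 n * (P u).card ≤ ((Aset (P u) false).card : ℝ)) :
    ∀ u : List (Fin N), 2 ≤ u.length → u.length ≤ 2 * ℓ →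
      ((Bset ℓ P u).card : ℝ) ≤ 250 * s * Real.logb 2 n * (P u.tail).card := by
  intro u hu2 hu
  have hlog : 0 ≤ Real.logb 2 n :=
    Real.logb_nonneg one_lt_two (by exact_mod_cast (by omega : 1 ≤ n))
  have hc : 0 ≤ (s : ℝ) * Real.logb 2 n := by positivity
  rcases (Bset ℓ P u).eq_empty_or_nonempty with hB | ⟨i, hi⟩
  · rw [hB, card_empty, Nat.cast_zero]
    positivity
  have hdiff : ∀ i ∈ Bset ℓ P u, ∃ x ∈ P u, ∃ y ∈ P u, x i ≠ y i := by
    intro i hi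
    simp only [Bset, mem_filter, mem_univ, true_and] at hi
    obtain ⟨w, hw, x, hx, y, hy, hxy⟩ := hi
    have hsub := subset_of_append (2 * ℓ) P hnest u (by omega) w hw.le
    exact ⟨x, hsub hx, y, hsub hy, hxy⟩
  have hPu : (P u).Nonempty := let ⟨x, hx, _⟩ := hdiff i hi; ⟨x, hx⟩
  obtain ⟨a, v, rfl⟩ : ∃ a v, u = a :: v :=
    List.exists_cons_of_length_pos (by omega)
  simp only [List.length_cons, List.tail_cons] at *
  have hsub : P (a :: v) ⊆ P v := hnest v (by omega) (by omega) a
  have hPv : (P v).Nonempty := hPu.mono hsub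
  have hcard : ((P (a :: v)).card : ℝ) ≤ (P v).card := by exact_mod_cast card_le_card hsub
  have hmul := mul_le_mul_of_nonneg_left hcard hc
  have hnn : 0 ≤ (s : ℝ) * Real.logb 2 n * (P v).card := by positivity
  rcases Nat.mod_two_eq_zero_or_one v.length with hv | hv
  · have h1 := hgood1 (a :: v) (by rw [List.length_cons]; omega) hu hPu
    have h0 := hgood0 v hv (by omega) (by omega) hPv
    have h : ((Bset ℓ P (a :: v)).card + ((Aset (P (a :: v)) true).card
        + (Aset (P v) false).card) : ℝ) ≤ n := by
      exact_mod_cast card_add_card_Aset_le hsub hPu (by decide) _ hdiff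
    linarith
  · have h0 := hgood0 (a :: v) (by rw [List.length_cons]; omega) (by simp) hu hPu
    have h1 := hgood1 v hv (by omega) hPv
    have h : ((Bset ℓ P (a :: v)).card + ((Aset (P (a :: v)) false).card
        + (Aset (P v) true).card) : ℝ) ≤ n := by
      exact_mod_cast card_add_card_Aset_le hsub hPu (by decide) _ hdiff
    linarith
end

section
/- Let n, s ≥ 1 and t ≥ 0 be integers, let A ⊆ [n], let Δ ⊆ A, and let R ⊆ {0,1}^n be a finite set with |R| ≤ s. Define U := {I ∈ [n]^s : I_k ∈ A for all k ∈ [s], and for every z ∈ R there is some k ∈ [s] with z_{I_k} = 0} and V := {I ∈ [n]^s : I_k ∈ A∖Δ for all k ∈ [s], and for every z ∈ R there is some k ∈ [s] with z_{I_k} = 0}. Then |V| · C(s − |R|, t) · |Δ|^t ≤ |U| · |A∖Δ|^t, where C(m, t) denotes the binomial coefficient. -/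
open scoped Classical
open Finset

/-- A family of `R.card` existential statements has witnesses in a set of size at most `R.card`. -/
theorem exists_witness_set {ι β : Type*} (R : Finset β) (p : β → ι → Prop)
    (h : ∀ z ∈ R, ∃ k, p z k) :
    ∃ W : Finset ι, W.card ≤ R.card ∧ ∀ z ∈ R, ∃ k ∈ W, p z k := by
  choose f hf using h
  refine ⟨R.attach.image fun z => f z.1 z.2, card_image_le.trans (by simp), fun z hz => ?_⟩
  exact ⟨f z hz, mem_image.2 ⟨⟨z, hz⟩, mem_attach _ _, rfl⟩, hf z hz⟩

/-- Exchanging the entries indexed by `T` of the tuples in `P`, which avoid `Δ`, for entries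
in `Δ`. -/
theorem card_mul_pow_le_of_exchange {ι α : Type*} [Fintype ι] (T : Finset ι) (Δ B : Finset α)
    (P Q : Finset (ι → α)) (hP : ∀ I ∈ P, ∀ k, I k ∈ B)
    (hPQ : ∀ I ∈ P, ∀ I' : ι → α, (∀ k ∈ T, I' k ∈ Δ) → (∀ k ∉ T, I' k = I k) → I' ∈ Q) :
    P.card * Δ.card ^ T.card ≤ Q.card * B.card ^ T.card := by
  have hc (C : Finset α) : (Fintype.piFinset fun _ : T => C).card = C.card ^ T.card := by simp
  rw [← hc Δ, ← hc B, ← card_product, ← card_product]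
  refine card_le_card_of_injOn
    (fun x => (fun k => if h : k ∈ T then x.2 ⟨k, h⟩ else x.1 k, fun k => x.1 k)) ?_ ?_
  · rintro ⟨I, J⟩ hx
    obtain ⟨hI, hJ⟩ := mem_product.1 (mem_coe.1 hx)
    rw [Fintype.mem_piFinset] at hJ
    refine mem_coe.2 (mem_product.2 ⟨hPQ I hI _ (fun k hk => ?_) (fun k hk => ?_), ?_⟩)
    · simpa [hk] using hJ ⟨k, hk⟩
    · simp [hk]
    · exact Fintype.mem_piFinset.2 fun k => hP I hI k
  · rintro ⟨I, J⟩ - ⟨I', J'⟩ - h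
    obtain ⟨h₁, h₂⟩ := Prod.mk.inj h
    refine Prod.ext (funext fun k => ?_) (funext fun k => ?_)
    · by_cases hk : k ∈ T
      · exact congrFun h₂ ⟨k, hk⟩
      · simpa [hk] using congrFun h₁ k
    · simpa using congrFun h₁ k

/-- the double-counting inequality
`|V| · C(s − |R|, t) · |Δ|^t ≤ |U| · |A∖Δ|^t`, where `U` (resp. `V`) is the set of
tuples `I ∈ [n]^s` with all entries in `A` (resp. `A∖Δ`) such that every `z ∈ R` has
a zero coordinate among the entries of `I`. -/
theorem stmt11 (n s t : ℕ) (hn : 1 ≤ n) (hs : 1 ≤ s)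
    (A Δ : Finset (Fin n)) (hΔA : Δ ⊆ A)
    (R : Finset (Fin n → Bool)) (hR : R.card ≤ s) :
    (univ.filter fun I : Fin s → Fin n =>
        (∀ k, I k ∈ A \ Δ) ∧ ∀ z ∈ R, ∃ k, z (I k) = false).card *
      Nat.choose (s - R.card) t * Δ.card ^ t ≤
    (univ.filter fun I : Fin s → Fin n =>
        (∀ k, I k ∈ A) ∧ ∀ z ∈ R, ∃ k, z (I k) = false).card *
      (A \ Δ).card ^ t := by
  set V := univ.filter fun I : Fin s → Fin n =>
    (∀ k, I k ∈ A \ Δ) ∧ ∀ z ∈ R, ∃ k, z (I k) = false with hV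
  set U := univ.filter fun I : Fin s → Fin n =>
    (∀ k, I k ∈ A) ∧ ∀ z ∈ R, ∃ k, z (I k) = false with hU
  have hVmem (I) : I ∈ V ↔ (∀ k, I k ∈ A \ Δ) ∧ ∀ z ∈ R, ∃ k, z (I k) = false := by simp [hV]
  have hUmem (I) : I ∈ U ↔ (∀ k, I k ∈ A) ∧ ∀ z ∈ R, ∃ k, z (I k) = false := by simp [hU]
  have hW (I : Fin s → Fin n) : ∃ W : Finset (Fin s), I ∈ V →
      W.card ≤ R.card ∧ ∀ z ∈ R, ∃ k ∈ W, z (I k) = false := by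
    by_cases hI : I ∈ V
    · obtain ⟨W, h⟩ := exists_witness_set R (fun z k => z (I k) = false) ((hVmem I).1 hI).2
      exact ⟨W, fun _ => h⟩
    · exact ⟨∅, fun h => absurd h hI⟩
  choose W hW using hW
  let S : Finset (Finset (Fin s)) := powersetCard t univ
  let Δset (I : Fin s → Fin n) : Finset (Fin s) := univ.filter fun k => I k ∈ Δ
  have hlower : V.card * (s - R.card).choose t ≤
      ∑ T ∈ S, (V.filter fun I => Disjoint T (W I)).card := by
    have hswap := sum_card_bipartiteAbove_eq_sum_card_bipartiteBelow
      (s := V) (t := S) (fun I T => Disjoint T (W I))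
    simp only [bipartiteAbove, bipartiteBelow] at hswap
    rw [← hswap, ← smul_eq_mul]
    refine card_nsmul_le_sum _ _ _ fun I hI => ?_
    calc (s - R.card).choose t ≤ ((W I)ᶜ.card).choose t := by
          refine Nat.choose_le_choose t ?_
          rw [card_compl, Fintype.card_fin]
          exact Nat.sub_le_sub_left (hW I hI).1 s
      _ = (powersetCard t (W I)ᶜ).card := (card_powersetCard _ _).symm
      _ ≤ _ := card_le_card fun T hT => by
          obtain ⟨hT₁, hT₂⟩ := mem_powersetCard.1 hT
          exact mem_filter.2 ⟨mem_powersetCard.2 ⟨subset_univ _, hT₂⟩,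
            subset_compl_iff_disjoint_right.1 hT₁⟩
  have hupper : ∑ T ∈ S, (U.filter fun I => Δset I = T).card ≤ U.card :=
    (sum_card_fiberwise_eq_card_filter U S Δset).trans_le (card_filter_le _ _)
  have hfiber (T) (hT : T ∈ S) : (V.filter fun I => Disjoint T (W I)).card * Δ.card ^ t ≤
      (U.filter fun I => Δset I = T).card * (A \ Δ).card ^ t := by
    rw [← (mem_powersetCard.1 hT).2]
    refine card_mul_pow_le_of_exchange T Δ (A \ Δ) _ _
      (fun I hI => ((hVmem I).1 (mem_filter.1 hI).1).1) fun I hI I' hT' hI' => ?_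
    obtain ⟨hIV, hdisj⟩ := mem_filter.1 hI
    have hIA := ((hVmem I).1 hIV).1
    refine mem_filter.2 ⟨(hUmem I').2 ⟨fun k => ?_, fun z hz => ?_⟩, ?_⟩
    · by_cases hk : k ∈ T
      · exact hΔA (hT' k hk)
      · exact hI' k hk ▸ (mem_sdiff.1 (hIA k)).1
    · obtain ⟨k, hk, hzk⟩ := (hW I hIV).2 z hz
      exact ⟨k, by rwa [hI' k (disjoint_right.1 hdisj hk)]⟩
    · ext k
      by_cases hk : k ∈ T
      · simp [Δset, hk, hT' k hk]
      · simp [Δset, hk, hI' k hk, (mem_sdiff.1 (hIA k)).2]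
  calc V.card * (s - R.card).choose t * Δ.card ^ t
      ≤ (∑ T ∈ S, (V.filter fun I => Disjoint T (W I)).card) * Δ.card ^ t :=
        Nat.mul_le_mul_right _ hlower
    _ ≤ (∑ T ∈ S, (U.filter fun I => Δset I = T).card) * (A \ Δ).card ^ t := by
        rw [sum_mul, sum_mul]
        exact sum_le_sum hfiber
    _ ≤ U.card * (A \ Δ).card ^ t := Nat.mul_le_mul_right _ hupper
end

section
/- For every constant C > 0 there exists n₀ ∈ ℕ such that the following holds for all n ≥ n₀ with √n an integer: for all A ⊆ [n], all Δ ⊆ A with |Δ| ≥ 100√n log₂ n, and all finite R ⊆ {0,1}^n with |R| ≤ √n / 2, defining U := {I ∈ [n]^{√n} : I_k ∈ A for all k, and for every z ∈ R there is some k with z_{I_k} = 0} and V := {I ∈ [n]^{√n} : I_k ∈ A∖Δ for all k, and for every z ∈ R there is some k with z_{I_k} = 0}, one has C · n⁵ · |V| ≤ |U|. -/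
open scoped Classical
open Finset

/-- If `#R ≤ s / 2` and every `z ∈ R` vanishes on some entry of `I`, then at least half of the
positions are not needed to witness this. -/
lemma exists_free_positions {α : Type*} {s : ℕ} {R : Finset (α → Bool)} (hR : 2 * #R ≤ s)
    {I : Fin s → α} (hI : ∀ z ∈ R, ∃ k, z (I k) = false) :
    ∃ F : Finset (Fin s), s ≤ 2 * #F ∧ ∀ z ∈ R, ∃ k ∉ F, z (I k) = false := by
  choose w hw using hI
  refine ⟨(R.attach.image fun z => w z.1 z.2)ᶜ, ?_, fun z hz => ⟨w z hz, ?_, hw z hz⟩⟩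
  · have h : #(R.attach.image fun z => w z.1 z.2) ≤ #R := card_image_le.trans_eq R.card_attach
    rw [card_compl, Fintype.card_fin]
    omega
  · simp only [mem_compl, not_not]
    exact mem_image.2 ⟨⟨z, hz⟩, mem_attach _ _, rfl⟩

/-- Swapping `I` and `w` at the positions where `w` lies in `Δ` is injective on tuples `I`
avoiding `Δ`; it turns a family of pairs `(I, w)` into pairs in `U × (A \ Δ)^s`. -/
lemma sum_card_pow_mul_card_pow_le {α : Type*} [Fintype α] [DecidableEq α] {s : ℕ} {A Δ : Finset α}
    {R : Finset (α → Bool)} (F : (Fin s → α) → Finset (Fin s))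
    (hF : ∀ I : Fin s → α, ((∀ k, I k ∈ A \ Δ) ∧ ∀ z ∈ R, ∃ k, z (I k) = false) →
      ∀ z ∈ R, ∃ k ∉ F I, z (I k) = false) :
    ∑ I : Fin s → α with (∀ k, I k ∈ A \ Δ) ∧ ∀ z ∈ R, ∃ k, z (I k) = false,
      #A ^ #(F I) * #(A \ Δ) ^ (s - #(F I)) ≤
    #{I : Fin s → α | (∀ k, I k ∈ A) ∧ ∀ z ∈ R, ∃ k, z (I k) = false} * #(A \ Δ) ^ s := by
  let W (I : Fin s → α) : Finset (Fin s → α) :=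
    Fintype.piFinset fun k => if k ∈ F I then A else A \ Δ
  have hW (I : Fin s → α) : #(W I) = #A ^ #(F I) * #(A \ Δ) ^ (s - #(F I)) := by
    simp only [W, Fintype.card_piFinset, apply_ite Finset.card, prod_ite, prod_const]
    congr 2
    · congr 1
      ext; simp
    · rw [← compl_filter, card_compl, Fintype.card_fin]
      congr 2
      ext; simp
  simp only [← hW]
  rw [← card_sigma]
  have hpi : #(Fintype.piFinset fun _ : Fin s => A \ Δ) = #(A \ Δ) ^ s := by simp
  rw [← hpi, ← card_product]
  refine card_le_card_of_injOn
    (fun p => (fun k => if p.2 k ∈ Δ then p.2 k else p.1 k,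
      fun k => if p.2 k ∈ Δ then p.1 k else p.2 k)) ?_ ?_
  · rintro ⟨I, w⟩ hp
    simp only [coe_sigma, Set.mem_sigma_iff, mem_coe, mem_filter, mem_univ, true_and, W,
      Fintype.mem_piFinset] at hp
    obtain ⟨hI, hw⟩ := hp
    have hwA (k) : w k ∈ A := by
      have := hw k
      split_ifs at this
      exacts [this, (mem_sdiff.1 this).1]
    simp only [mem_coe, mem_product, mem_filter, mem_univ, true_and, Fintype.mem_piFinset]
    refine ⟨⟨fun k => ?_, fun z hz => ?_⟩, fun k => ?_⟩
    · split_ifs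
      exacts [hwA k, (mem_sdiff.1 (hI.1 k)).1]
    · obtain ⟨k, hk, hzk⟩ := hF I hI z hz
      have := hw k
      rw [if_neg hk] at this
      exact ⟨k, by rwa [if_neg (mem_sdiff.1 this).2]⟩
    · split_ifs with h
      exacts [hI.1 k, mem_sdiff.2 ⟨hwA k, h⟩]
  · rintro ⟨I, w⟩ hp ⟨I', w'⟩ hp' h
    simp only [coe_sigma, Set.mem_sigma_iff, mem_coe, mem_filter, mem_univ, true_and] at hp hp'
    simp only [Prod.mk.injEq, funext_iff] at h
    have key (k) : I k = I' k ∧ w k = w' k := by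
      have h1 := h.1 k
      have h2 := h.2 k
      have h3 := (mem_sdiff.1 (hp.1.1 k)).2
      have h4 := (mem_sdiff.1 (hp'.1.1 k)).2
      split_ifs at h1 h2 with h5 h6 h6
      · exact ⟨h2, h1⟩
      · exact absurd (h1 ▸ h5) h4
      · exact absurd (h1 ▸ h6) h3
      · exact ⟨h1, h2⟩
    obtain rfl : I = I' := funext fun k => (key k).1
    obtain rfl : w = w' := funext fun k => (key k).2
    rfl

/-- The gain factor: `(1 + d / a) ^ f ≥ n ^ 50` when `d ≥ 100 √n log₂ n` and `f ≥ √n / 2`. -/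
lemma pow_fifty_le_ratio_pow {n s f : ℕ} (hn : 1 < n) (hs : s * s = n) (hf : s ≤ 2 * f)
    {a d : ℝ} (ha : 0 < a) (had : a + d ≤ n) (hd : 100 * (s : ℝ) * Real.logb 2 n ≤ d) :
    (n : ℝ) ^ 50 ≤ ((a + d) / a) ^ f := by
  have hn1 : (1 : ℝ) < n := by exact_mod_cast hn
  have hs0 : (0 : ℝ) < s := by
    rcases Nat.eq_zero_or_pos s with rfl | h
    · omega
    · exact_mod_cast h
  have hss : (s : ℝ) * s = n := by exact_mod_cast hs
  have hL : 0 < Real.logb 2 n := Real.logb_pos (by norm_num) hn1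
  have hd0 : 0 < d := lt_of_lt_of_le (by positivity) hd
  set x : ℝ := d / n with hx
  have hx0 : 0 ≤ x := by positivity
  have hx1 : x ≤ 1 := (div_le_one (by linarith)).2 (by linarith)
  have hxs : 100 * Real.logb 2 n ≤ x * s := by
    rw [hx, div_mul_eq_mul_div, le_div_iff₀ (by linarith), mul_comm d]
    calc 100 * Real.logb 2 n * n = s * (100 * s * Real.logb 2 n) := by
          linear_combination (-100 * Real.logb 2 n) * hss
      _ ≤ s * d := by gcongr
  have hbase : (2 : ℝ) ^ x ≤ (a + d) / a := by
    have h1 : (1 + 1 : ℝ) ^ x ≤ 1 + x * 1 :=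
      rpow_one_add_le_one_add_mul_self (by norm_num) hx0 hx1
    have h2 : x ≤ d / a := div_le_div_of_nonneg_left hd0.le ha (by linarith)
    rw [add_div, div_self ha.ne']
    norm_num at h1
    linarith
  have hf' : (s : ℝ) ≤ 2 * f := by exact_mod_cast hf
  calc (n : ℝ) ^ 50 = (2 : ℝ) ^ (Real.logb 2 n * (50 : ℕ)) := by
        rw [Real.rpow_mul_natCast (by norm_num),
          Real.rpow_logb (by norm_num) (by norm_num) (by linarith)]
    _ ≤ (2 : ℝ) ^ (x * f) := by
        apply Real.rpow_le_rpow_of_exponent_le (by norm_num)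
        push_cast
        nlinarith
    _ = ((2 : ℝ) ^ x) ^ f := Real.rpow_mul_natCast (by norm_num) _ _
    _ ≤ ((a + d) / a) ^ f := by gcongr

/-- for every constant `C > 0` and all large enough `n` with `√n ∈ ℕ`,
if `Δ ⊆ A ⊆ [n]` with `|Δ| ≥ 100 √n log₂ n` and `R ⊆ {0,1}^n` with `|R| ≤ √n/2`, then
`C · n⁵ · |V| ≤ |U|`, where `U` (resp. `V`) is the set of tuples `I ∈ [n]^{√n}` with
all entries in `A` (resp. `A∖Δ`) such that every `z ∈ R` has a zero coordinate among
the entries of `I`. -/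
theorem stmt12 (C : ℝ) (hC : 0 < C) :
    ∃ n₀ : ℕ, ∀ n : ℕ, n₀ ≤ n → ∀ s : ℕ, s * s = n →
    ∀ A Δ : Finset (Fin n), Δ ⊆ A →
      100 * (s : ℝ) * Real.logb 2 n ≤ (Δ.card : ℝ) →
    ∀ R : Finset (Fin n → Bool), (R.card : ℝ) ≤ (s : ℝ) / 2 →
      C * (n : ℝ) ^ 5 * ((univ.filter fun I : Fin s → Fin n =>
          (∀ k, I k ∈ A \ Δ) ∧ ∀ z ∈ R, ∃ k, z (I k) = false).card : ℝ) ≤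
      ((univ.filter fun I : Fin s → Fin n =>
          (∀ k, I k ∈ A) ∧ ∀ z ∈ R, ∃ k, z (I k) = false).card : ℝ) := by
  refine ⟨max 2 ⌈C⌉₊, fun n hn s hs A Δ hΔ hd R hR => ?_⟩
  have hn2 : 1 < n := (le_max_left _ _).trans hn
  have hCn : C ≤ n := (Nat.le_ceil C).trans (by exact_mod_cast (le_max_right _ _).trans hn)
  have hn1 : (1 : ℝ) ≤ n := by exact_mod_cast hn2.le
  have hR' : 2 * #R ≤ s := by
    have : (2 : ℝ) * #R ≤ s := by linarith
    exact_mod_cast this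
  have hfree (I : Fin s → Fin n) : ∃ F : Finset (Fin s),
      ((∀ k, I k ∈ A \ Δ) ∧ ∀ z ∈ R, ∃ k, z (I k) = false) →
        s ≤ 2 * #F ∧ ∀ z ∈ R, ∃ k ∉ F, z (I k) = false := by
    by_cases h : ∀ z ∈ R, ∃ k, z (I k) = false
    · obtain ⟨F, hF⟩ := exists_free_positions hR' h
      exact ⟨F, fun _ => hF⟩
    · exact ⟨∅, fun h' => absurd h'.2 h⟩
  choose F hF using hfree
  have hcount := sum_card_pow_mul_card_pow_le F fun I hI => (hF I hI).2
  set V : Finset (Fin s → Fin n) :=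
    univ.filter fun I => (∀ k, I k ∈ A \ Δ) ∧ ∀ z ∈ R, ∃ k, z (I k) = false
  set U : Finset (Fin s → Fin n) :=
    univ.filter fun I => (∀ k, I k ∈ A) ∧ ∀ z ∈ R, ∃ k, z (I k) = false
  rcases V.eq_empty_or_nonempty with hVe | ⟨I₀, hI₀⟩
  · rw [hVe]; simp
  have hspos : 0 < s := Nat.pos_of_ne_zero (by rintro rfl; omega)
  have ha : (0 : ℝ) < #(A \ Δ) := by
    exact_mod_cast card_pos.2 ⟨_, (mem_filter.1 hI₀).2.1 ⟨0, hspos⟩⟩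
  have hcard : (#(A \ Δ) : ℝ) + #Δ = #A := by exact_mod_cast card_sdiff_add_card_eq_card hΔ
  have hAn : (#A : ℝ) ≤ n := by exact_mod_cast card_finset_fin_le A
  have hterm : ∀ I ∈ V, C * (n : ℝ) ^ 5 * (#(A \ Δ) : ℝ) ^ s ≤
      (#A : ℝ) ^ #(F I) * (#(A \ Δ) : ℝ) ^ (s - #(F I)) := by
    intro I hI
    have hgain := pow_fifty_le_ratio_pow hn2 hs (hF I (mem_filter.1 hI).2).1 ha
      (hcard.trans_le hAn) hd
    rw [hcard] at hgain
    have hfs : #(F I) ≤ s := card_finset_fin_le _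
    calc C * (n : ℝ) ^ 5 * (#(A \ Δ) : ℝ) ^ s
        ≤ (n : ℝ) ^ 50 * (#(A \ Δ) : ℝ) ^ s := by
          gcongr
          calc C * (n : ℝ) ^ 5 ≤ n * (n : ℝ) ^ 5 := by gcongr
            _ = (n : ℝ) ^ 6 := by ring
            _ ≤ (n : ℝ) ^ 50 := pow_le_pow_right₀ hn1 (by norm_num)
      _ ≤ ((#A : ℝ) / #(A \ Δ)) ^ #(F I) * (#(A \ Δ) : ℝ) ^ s := by gcongr
      _ = (#A : ℝ) ^ #(F I) * (#(A \ Δ) : ℝ) ^ (s - #(F I)) := by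
          rw [← pow_mul_pow_sub _ hfs, div_pow, ← mul_assoc,
            div_mul_cancel₀ _ (pow_pos ha _).ne']
  have hsum := sum_le_sum hterm
  rw [sum_const, nsmul_eq_mul] at hsum
  have hcount' : ∑ I ∈ V, (#A : ℝ) ^ #(F I) * (#(A \ Δ) : ℝ) ^ (s - #(F I)) ≤
      #U * (#(A \ Δ) : ℝ) ^ s := by exact_mod_cast hcount
  refine le_of_mul_le_mul_right ?_ (pow_pos ha s)
  linarith
end

section
/- There exists n₀ ∈ ℕ such that for all n ≥ n₀ with √n an integer, the following holds: for any x, y ∈ {0,1}^n lying in the middle layers with |{i ∈ [n] : x_i = y_i = 0}| ≤ n/2 − 100√n log₂ n, one has |{i ∈ [n] : x_i = y_i = 1}| ≤ n/2 − 98√n log₂ n, and the number of tuples I ∈ [n]^{√n} satisfying x_{I_k} = 1 and y_{I_k} = 1 for all k ∈ [√n] is at most n^{√n} · 2^{−√n} · n^{−10}. Equivalently, for a uniformly random tuple I ∈ [n]^{√n} (i.e., a uniformly random size-√n term T(w) = w_{I_1} ∧ ⋯ ∧ w_{I_{√n}}), the probability that T(x) = T(y) = 1 is at most 2^{−√n}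 · n^{−10}. -/
open Finset

theorem card_filter_false_add_hwt {n : ℕ} (x y : Fin n → Bool) :
    (univ.filter fun i : Fin n => x i = false ∧ y i = false).card + hwt x + hwt y =
      n + (univ.filter fun i : Fin n => x i = true ∧ y i = true).card := by
  unfold hwt
  refine Eq.trans ?_ (congrArg (· + _) (show ∑ _i : Fin n, 1 = n by simp))
  simp only [Finset.card_filter, ← Finset.sum_add_distrib]
  refine Finset.sum_congr rfl fun i _ => ?_
  cases x i <;> cases y i <;> simp

theorem card_filter_forall_mem_s14 {α : Type*} [Fintype α] (p : α → Prop)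
    [DecidablePred p] (s : ℕ) [DecidablePred fun I : Fin s → α => ∀ k, p (I k)] :
    (univ.filter fun I : Fin s → α => ∀ k, p (I k)).card = (univ.filter p).card ^ s := by
  have h : (univ.filter fun I : Fin s → α => ∀ k, p (I k)) =
      Fintype.piFinset fun _ => univ.filter p := by
    ext I
    simp [Fintype.mem_piFinset]
  rw [h, Fintype.card_piFinset_const]

/-- for all large `n` with `√n ∈ ℕ` and all `x, y` in the middle layers
with `|{i : x_i = y_i = 0}| ≤ n/2 − 100√n log₂ n`, one has
`|{i : x_i = y_i = 1}| ≤ n/2 − 98√n log₂ n`, and the number of tuples `I ∈ [n]^{√n}`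
(i.e. size-`√n` terms) satisfied by both `x` and `y` is at most
`n^{√n} · 2^{−√n} · n^{−10}`. -/
theorem stmt14 :
    ∃ n₀ : ℕ, ∀ n : ℕ, n₀ ≤ n → ∀ s : ℕ, s * s = n →
    ∀ x y : Fin n → Bool, MiddleLayers n s x → MiddleLayers n s y →
    ((univ.filter fun i : Fin n => x i = false ∧ y i = false).card : ℝ) ≤
        (n : ℝ) / 2 - 100 * s * Real.logb 2 n →
    ((univ.filter fun i : Fin n => x i = true ∧ y i = true).card : ℝ) ≤
        (n : ℝ) / 2 - 98 * s * Real.logb 2 n ∧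
    ((univ.filter fun I : Fin s → Fin n =>
        ∀ k, x (I k) = true ∧ y (I k) = true).card : ℝ) ≤
      (n : ℝ) ^ s / ((2 : ℝ) ^ s * (n : ℝ) ^ 10) := by
  refine ⟨2, fun n hn s hs x y hx hy h => ?_⟩
  have hn2 : (2 : ℝ) ≤ n := by exact_mod_cast hn
  have hs0 : s ≠ 0 := by
    rintro rfl
    omega
  have hspos : (0 : ℝ) < s := by exact_mod_cast Nat.pos_of_ne_zero hs0
  have hsR : (s : ℝ) * s = n := by exact_mod_cast hs
  have hL : 1 ≤ Real.logb 2 n := by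
    rw [Real.le_logb_iff_rpow_le (by norm_num) (by linarith)]
    simpa using hn2
  have hlog : Real.log n ≤ Real.logb 2 n := by
    rw [Real.logb]
    have h2 := Real.log_two_lt_d9
    exact le_div_self (Real.log_nonneg (by linarith)) (Real.log_pos (by norm_num)) (by linarith)
  have hcard : ((univ.filter fun i : Fin n => x i = false ∧ y i = false).card : ℝ) + hwt x + hwt y =
      n + (univ.filter fun i : Fin n => x i = true ∧ y i = true).card := by
    exact_mod_cast card_filter_false_add_hwt x y
  have hx2 : 2 * (hwt x : ℝ) ≤ n + 2 * s := by exact_mod_cast hx.2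
  have hy2 : 2 * (hwt y : ℝ) ≤ n + 2 * s := by exact_mod_cast hy.2
  have hones : ((univ.filter fun i : Fin n => x i = true ∧ y i = true).card : ℝ) ≤
      (n : ℝ) / 2 - 98 * s * Real.logb 2 n := by
    nlinarith [mul_le_mul_of_nonneg_left hL hspos.le]
  refine ⟨hones, ?_⟩
  rw [card_filter_forall_mem_s14 (fun i => x i = true ∧ y i = true) s]
  push_cast
  set L := Real.logb 2 n
  have hexp : ((univ.filter fun i : Fin n => x i = true ∧ y i = true).card : ℝ) ≤
      (n : ℝ) / 2 * Real.exp (-(196 * L / s)) := by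
    have h1 := Real.add_one_le_exp (-(196 * L / s))
    refine hones.trans ?_
    calc (n : ℝ) / 2 - 98 * s * L = n / 2 * (-(196 * L / s) + 1) := by
          rw [← hsR]
          field_simp
          ring
      _ ≤ _ := by gcongr
  have hdecay : Real.exp (-(196 * L / s)) ^ s ≤ ((n : ℝ) ^ 10)⁻¹ := by
    rw [← Real.exp_nat_mul]
    calc Real.exp (s * -(196 * L / s)) ≤ Real.exp (-((10 : ℕ) * Real.log n)) := by
          apply Real.exp_le_exp.mpr
          have h1 : (s : ℝ) * -(196 * L / s) = -(196 * L) := by field_simp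
          rw [h1]
          push_cast
          linarith
      _ = _ := by rw [Real.exp_neg, Real.exp_nat_mul, Real.exp_log (by linarith)]
  calc ((univ.filter fun i : Fin n => x i = true ∧ y i = true).card : ℝ) ^ s
      ≤ ((n : ℝ) / 2 * Real.exp (-(196 * L / s))) ^ s := by gcongr
    _ = ((n : ℝ) / 2) ^ s * Real.exp (-(196 * L / s)) ^ s := mul_pow _ _ _
    _ ≤ ((n : ℝ) / 2) ^ s * ((n : ℝ) ^ 10)⁻¹ := by gcongr
    _ = (n : ℝ) ^ s / ((2 : ℝ) ^ s * (n : ℝ) ^ 10) := by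
        rw [div_pow, ← div_eq_mul_inv, div_div]
end

section
/- There exist a constant c > 0 and n₀ ∈ ℕ such that for all n ≥ n₀ with √n an integer, setting N := 2^{√n}, one has ((n/2 − √n)/n)^{√n} · (1 − ((n/2 + √n)/n)^{√n})^{N−1} ≥ c / N. -/
theorem Real.exp_neg_two_mul_le_one_sub {x : ℝ} (h0 : 0 ≤ x) (h1 : x ≤ 1 / 2) :
    Real.exp (-(2 * x)) ≤ 1 - x := by
  rw [Real.exp_neg, inv_le_comm₀ (Real.exp_pos _) (by linarith)]
  refine le_trans ?_ (Real.add_one_le_exp (2 * x))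
  rw [inv_le_iff_one_le_mul₀ (by linarith)]
  nlinarith

theorem Real.exp_neg_two_mul_mul_le_one_sub_pow {x : ℝ} (h0 : 0 ≤ x) (h1 : x ≤ 1 / 2) (k : ℕ) :
    Real.exp (-(2 * (k * x))) ≤ (1 - x) ^ k := by
  calc Real.exp (-(2 * (k * x))) = Real.exp (-(2 * x)) ^ k := by
        rw [← Real.exp_nat_mul]; ring_nf
    _ ≤ (1 - x) ^ k :=
        pow_le_pow_left₀ (Real.exp_pos _).le (Real.exp_neg_two_mul_le_one_sub h0 h1) k

/-- there is a constant `c > 0` such that for all large `n` with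
`√n ∈ ℕ` and `N := 2^{√n}`,
`((n/2 − √n)/n)^{√n} · (1 − ((n/2 + √n)/n)^{√n})^{N−1} ≥ c / N`. -/
theorem stmt15 :
    ∃ c : ℝ, 0 < c ∧ ∃ n₀ : ℕ, ∀ n : ℕ, n₀ ≤ n → ∀ s : ℕ, s * s = n →
      c / 2 ^ s ≤
        (((n : ℝ) / 2 - s) / n) ^ s *
          (1 - (((n : ℝ) / 2 + s) / n) ^ s) ^ (2 ^ s - 1) := by
  refine ⟨Real.exp (-4) * Real.exp (-(2 * Real.exp 2)), by positivity, 25, ?_⟩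
  rintro n hn s rfl
  have hs : 5 ≤ s := by nlinarith
  have hsR : (5 : ℝ) ≤ s := by exact_mod_cast hs
  have hs0 : (s : ℝ) ≠ 0 := by positivity
  have hsub : (((s * s : ℕ) : ℝ) / 2 - s) / (s * s : ℕ) = (1 - 2 / s) / 2 := by
    push_cast; field_simp
  have hadd : (((s * s : ℕ) : ℝ) / 2 + s) / (s * s : ℕ) = (1 + 2 / s) / 2 := by
    push_cast; field_simp
  rw [hsub, hadd, div_pow, div_pow]
  have hfst : Real.exp (-4) ≤ (1 - 2 / (s : ℝ)) ^ s := by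
    have h := Real.exp_neg_two_mul_mul_le_one_sub_pow (x := 2 / (s : ℝ)) (by positivity)
      (by rw [div_le_iff₀ (by positivity)]; linarith) s
    rwa [mul_div_cancel₀ _ hs0, show (2 * 2 : ℝ) = 4 by norm_num] at h
  have hup : (1 + 2 / (s : ℝ)) ^ s ≤ Real.exp 2 := by
    calc (1 + 2 / (s : ℝ)) ^ s ≤ Real.exp (2 / s) ^ s :=
          pow_le_pow_left₀ (by positivity) (by linarith [Real.add_one_le_exp (2 / (s : ℝ))]) s
      _ = Real.exp 2 := by rw [← Real.exp_nat_mul, mul_div_cancel₀ _ hs0]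
  have hexp : Real.exp 2 ≤ 16 := by
    rw [show (2 : ℝ) = 1 + 1 by norm_num, Real.exp_add]
    nlinarith [Real.exp_one_lt_d9, Real.exp_pos 1]
  have hpow : (32 : ℝ) ≤ 2 ^ s := by
    calc (32 : ℝ) = 2 ^ 5 := by norm_num
      _ ≤ 2 ^ s := pow_le_pow_right₀ (by norm_num) hs
  set p : ℝ := (1 + 2 / (s : ℝ)) ^ s / 2 ^ s with hp
  have hp0 : 0 ≤ p := by positivity
  have hp1 : p ≤ 1 / 2 := by
    rw [hp, div_le_iff₀ (by positivity)]; linarith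
  have hsnd : Real.exp (-(2 * Real.exp 2)) ≤ (1 - p) ^ (2 ^ s - 1) := by
    calc Real.exp (-(2 * Real.exp 2)) ≤ Real.exp (-(2 * ((2 ^ s : ℕ) * p))) := by
          have : ((2 ^ s : ℕ) : ℝ) * p = (1 + 2 / (s : ℝ)) ^ s := by
            rw [hp, Nat.cast_pow, Nat.cast_ofNat, mul_div_cancel₀ _ (by positivity)]
          rw [this, Real.exp_le_exp]; linarith
      _ ≤ (1 - p) ^ (2 ^ s) := Real.exp_neg_two_mul_mul_le_one_sub_pow hp0 hp1 _
      _ ≤ (1 - p) ^ (2 ^ s - 1) :=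
          pow_le_pow_of_le_one (by linarith) (by linarith) (Nat.sub_le _ _)
  rw [mul_div_right_comm]
  have hnonneg : 0 ≤ (1 - 2 / (s : ℝ)) ^ s := (Real.exp_pos _).le.trans hfst
  gcongr
end

section
/- Let f : {0,1}^n → {0,1} be a Boolean function. For i ∈ [n], let Edges_i^1 := {(x, x^{\{i\}}) : x_i = 0, f(x) = 0, f(x^{\{i\}}) = 1} be the set of strictly monotone edges along direction i, and Edges_i^0 := {(x, x^{\{i\}}) : x_i = 0, f(x) = 1, f(x^{\{i\}}) = 0} be the set of strictly anti-monotone edges along direction i, where x^{\{i\}} denotes x with the i-th bit flipped. Then for every i ∈ [n] and every unate function g : {0,1}^n → {0,1}, one has |f^{-1}(1) △ g^{-1}(1)| ≥ min(|Edges_i^1|, |Edges_i^0|). Consequently, if f^{-1}(1) ≠ ∅, then reldist(f, unate) ≥ min(|Edges_i^1|, |Edges_i^0|) / |f^{-1}(1)| for every i ∈ [n]. -/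
open Finset

/-- `g` is unate: for some `a ∈ {0,1}^n`, `x ↦ g (x ⊕ a)` is monotone. -/
def Unate {n : ℕ} (g : (Fin n → Bool) → Bool) : Prop :=
  ∃ a : Fin n → Bool, Monotone fun x : Fin n → Bool => g fun i => xor (x i) (a i)

/-- The strictly monotone edges of `f` along direction `i` (counted by their bottom
endpoints `x` with `x_i = 0`, `f x = 0`, `f (x^{i}) = 1`). -/
def edges1 {n : ℕ} (f : (Fin n → Bool) → Bool) (i : Fin n) : Finset (Fin n → Bool) :=
  univ.filter fun x => x i = false ∧ f x = false ∧ f (Function.update x i true) = true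

/-- The strictly anti-monotone edges of `f` along direction `i`. -/
def edges0 {n : ℕ} (f : (Fin n → Bool) → Bool) (i : Fin n) : Finset (Fin n → Bool) :=
  univ.filter fun x => x i = false ∧ f x = true ∧ f (Function.update x i true) = false

/-- A unate function is monotone or antitone along each direction. -/
theorem Unate.le_update_or_update_le {n : ℕ} {g : (Fin n → Bool) → Bool} (hg : Unate g)
    (i : Fin n) :
    (∀ x, x i = false → g x ≤ g (Function.update x i true)) ∨
      (∀ x, x i = false → g (Function.update x i true) ≤ g x) := by
  obtain ⟨a, ha⟩ := hg
  have cancel : ∀ y : Fin n → Bool, (fun j => xor (xor (y j) (a j)) (a j)) = y := by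
    intro y
    funext j
    simp
  have mono : ∀ y z : Fin n → Bool,
      (∀ j, xor (y j) (a j) ≤ xor (z j) (a j)) → g y ≤ g z := by
    intro y z hyz
    have h := @ha (fun j => xor (y j) (a j)) (fun j => xor (z j) (a j)) hyz
    simpa only [cancel] using h
  cases hai : a i with
  | false =>
    refine Or.inl fun x hx => mono _ _ fun j => ?_
    by_cases hj : j = i
    · subst hj
      simp [hai, hx]
    · simp [Function.update_of_ne hj]
  | true =>
    refine Or.inr fun x hx => mono _ _ fun j => ?_
    by_cases hj : j = i
    · subst hj
      simp [hai, hx]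
    · simp [Function.update_of_ne hj]

/-- If `f` and `g` disagree at an endpoint of each of a family of edges along direction `i`,
then they differ in at least as many points as there are edges in the family. -/
theorem card_le_card_symmDiff_of_edges {n : ℕ} (f g : (Fin n → Bool) → Bool) (i : Fin n)
    (S : Finset (Fin n → Bool)) (hS : ∀ x ∈ S, x i = false)
    (h : ∀ x ∈ S, f x ≠ g x ∨ f (Function.update x i true) ≠ g (Function.update x i true)) :
    S.card ≤ (symmDiff (univ.filter fun z : Fin n → Bool => f z = true)
      (univ.filter fun z : Fin n → Bool => g z = true)).card := by
  have mem : ∀ z, f z ≠ g z → z ∈ symmDiff (univ.filter fun z : Fin n → Bool => f z = true)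
      (univ.filter fun z : Fin n → Bool => g z = true) := by
    intro z hz
    simp only [mem_symmDiff, mem_filter, mem_univ, true_and]
    cases hf : f z <;> cases hg : g z <;> simp_all
  have reset : ∀ x ∈ S, Function.update
      (if f x ≠ g x then x else Function.update x i true) i false = x := by
    intro x hx
    have hxi : Function.update x i false = x := by
      rw [← hS x hx, Function.update_eq_self]
    split_ifs
    · exact hxi
    · rw [Function.update_idem, hxi]
  refine card_le_card_of_injOn
    (fun x => if f x ≠ g x then x else Function.update x i true) ?_ ?_
  · intro x hx
    by_cases hfg : f x ≠ g x
    · simpa only [if_pos hfg, mem_coe] using mem x hfg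
    · simpa only [if_neg hfg, mem_coe] using mem _ ((h x hx).resolve_left hfg)
  · intro x hx y hy hxy
    rw [← reset x hx, ← reset y hy]
    exact congrArg (fun z => Function.update z i false) hxy

theorem min_card_edges_le_card_symmDiff {n : ℕ} (f : (Fin n → Bool) → Bool) (i : Fin n)
    (g : (Fin n → Bool) → Bool) (hg : Unate g) :
    min (edges1 f i).card (edges0 f i).card ≤
      (symmDiff (univ.filter fun z : Fin n → Bool => f z = true)
        (univ.filter fun z : Fin n → Bool => g z = true)).card := by
  rcases hg.le_update_or_update_le i with hmono | hanti
  · refine (min_le_right _ _).trans (card_le_card_symmDiff_of_edges f g i _ ?_ ?_)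
    · intro x hx
      exact (mem_filter.mp hx).2.1
    · intro x hx
      obtain ⟨hxi, hfx, hfu⟩ := (mem_filter.mp hx).2
      have hle := hmono x hxi
      rw [hfx, hfu]
      revert hle
      cases g x <;> cases g (Function.update x i true) <;> decide
  · refine (min_le_left _ _).trans (card_le_card_symmDiff_of_edges f g i _ ?_ ?_)
    · intro x hx
      exact (mem_filter.mp hx).2.1
    · intro x hx
      obtain ⟨hxi, hfx, hfu⟩ := (mem_filter.mp hx).2
      have hle := hanti x hxi
      rw [hfx, hfu]
      revert hle
      cases g x <;> cases g (Function.update x i true) <;> decide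

/-- for every `i` and every unate `g`,
`|f⁻¹(1) △ g⁻¹(1)| ≥ min(|Edges_i^1|, |Edges_i^0|)`; consequently, if `f⁻¹(1) ≠ ∅`,
then `reldist(f, g) ≥ min(|Edges_i^1|, |Edges_i^0|) / |f⁻¹(1)|` for every unate `g`
(i.e. `reldist(f, unate)` is at least this quantity). -/
theorem stmt16 (n : ℕ) (f : (Fin n → Bool) → Bool) :
    (∀ i : Fin n, ∀ g : (Fin n → Bool) → Bool, Unate g →
      min (edges1 f i).card (edges0 f i).card ≤
        (symmDiff (univ.filter fun z : Fin n → Bool => f z = true)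
          (univ.filter fun z : Fin n → Bool => g z = true)).card) ∧
    ((univ.filter fun z : Fin n → Bool => f z = true).Nonempty →
      ∀ i : Fin n, ∀ g : (Fin n → Bool) → Bool, Unate g →
        (min (edges1 f i).card (edges0 f i).card : ℝ) /
            ((univ.filter fun z : Fin n → Bool => f z = true).card : ℝ) ≤
          ((symmDiff (univ.filter fun z : Fin n → Bool => f z = true)
              (univ.filter fun z : Fin n → Bool => g z = true)).card : ℝ) /
            ((univ.filter fun z : Fin n → Bool => f z = true).card : ℝ)) := by
  refine ⟨min_card_edges_le_card_symmDiff f, fun _ i g hg => ?_⟩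
  gcongr
  exact_mod_cast min_card_edges_le_card_symmDiff f i g hg
end

section
/- Let M be a sandwiched (2ℓ)-level multiplexer tree and let H = (h_u) be a family of functions h_u : {0,1}^n → {0,1}, one per leaf, such that every h_u is a constant function (constant 0 or constant 1). Then the sandwiched (2ℓ)-level Talagrand function f_{M,H} : {0,1}^n → {0,1} is monotone. -/
open scoped Classical
open Finset

/-- Result of the sandwiched multiplexer map: a leaf (encoded as the list of child
indices from the leaf up to the root) or a special label `0*`, `1*`. -/
inductive SMuxResult : Type where
  | leaf : List ℕ → SMuxResult
  | zeroStar : SMuxResult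
  | oneStar : SMuxResult

/-- The edge into node `v` (at level `v.length`) is activated by `x`: the size-`n`
term on it (odd level) is satisfied, resp. the size-`n` clause on it (even level)
is falsified. -/
def SActivated {n : ℕ} (M : List ℕ → Fin n → Fin n)
    (x : Fin n → Bool) (v : List ℕ) : Prop :=
  if v.length % 2 = 1 then ∀ k, x (M v k) = true else ∀ k, x (M v k) = false

/-- Descend along the unique activation path: a node at even level has `N1` children
and a node at odd level has `N0` children. -/
noncomputable def SGammaAux (N1 N0 : ℕ) {n : ℕ} (M : List ℕ → Fin n → Fin n)
    (x : Fin n → Bool) : ℕ → List ℕ → SMuxResult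
  | 0, u => SMuxResult.leaf u
  | fuel + 1, u =>
    if h : ∃! a : ℕ, a < (if u.length % 2 = 0 then N1 else N0) ∧
        SActivated M x (a :: u) then
      SGammaAux N1 N0 M x fuel (h.exists.choose :: u)
    else if ∀ a : ℕ, a < (if u.length % 2 = 0 then N1 else N0) →
        ¬ SActivated M x (a :: u) then
      (if u.length % 2 = 0 then SMuxResult.zeroStar else SMuxResult.oneStar)
    else
      (if u.length % 2 = 0 then SMuxResult.oneStar else SMuxResult.zeroStar)

/-- The sandwiched `(2ℓ)`-level Talagrand function `f_{M,H}`: `0` below the sandwich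
layers (`|x| < 3n/4`), `1` above them (`|x| > 3n/4 + 1`), and determined by the
multiplexer map and the leaf functions `H` within the sandwich layers. -/
noncomputable def STalagrand (ℓ N1 N0 : ℕ) {n : ℕ} (M : List ℕ → Fin n → Fin n)
    (H : List ℕ → (Fin n → Bool) → Bool) (x : Fin n → Bool) : Bool :=
  if 4 * hwt x < 3 * n then false
  else if 3 * n + 4 < 4 * hwt x then true
  else
    match SGammaAux N1 N0 M x (2 * ℓ) [] with
    | SMuxResult.zeroStar => false
    | SMuxResult.oneStar => true
    | SMuxResult.leaf u => H u x

theorem SActivated.mono_of_odd {n : ℕ} {M : List ℕ → Fin n → Fin n} {x y : Fin n → Bool}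
    {v : List ℕ} (hxy : x ≤ y) (hv : v.length % 2 = 1) (hx : SActivated M x v) :
    SActivated M y v := by
  unfold SActivated at *
  rw [if_pos hv] at *
  intro k
  have h := hxy (M v k)
  rw [hx k] at h
  exact top_le_iff.mp h

theorem SActivated.anti_of_even {n : ℕ} {M : List ℕ → Fin n → Fin n} {x y : Fin n → Bool}
    {v : List ℕ} (hxy : x ≤ y) (hv : ¬ v.length % 2 = 1) (hy : SActivated M y v) :
    SActivated M x v := by
  unfold SActivated at *
  rw [if_neg hv] at *
  intro k
  have h := hxy (M v k)
  rw [hy k] at h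
  exact le_bot_iff.mp h

/-- The value a result of the multiplexer map contributes, given the leaf functions. -/
def SMuxResult.value {n : ℕ} (H : List ℕ → (Fin n → Bool) → Bool) (x : Fin n → Bool) :
    SMuxResult → Bool
  | SMuxResult.zeroStar => false
  | SMuxResult.oneStar => true
  | SMuxResult.leaf u => H u x

/-- One step of the descent, phrased through the activated children of `u`. -/
theorem SGammaAux_succ_cases (N1 N0 : ℕ) {n : ℕ} (M : List ℕ → Fin n → Fin n)
    (x : Fin n → Bool) (k : ℕ) (u : List ℕ) {N : ℕ}
    (hN : N = if u.length % 2 = 0 then N1 else N0) :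
    (∃ a, (∀ b, (b < N ∧ SActivated M x (b :: u)) ↔ b = a) ∧
        SGammaAux N1 N0 M x (k + 1) u = SGammaAux N1 N0 M x k (a :: u)) ∨
    ((∀ a, ¬ (a < N ∧ SActivated M x (a :: u))) ∧
        SGammaAux N1 N0 M x (k + 1) u =
          if u.length % 2 = 0 then SMuxResult.zeroStar else SMuxResult.oneStar) ∨
    ((∃ a b, a ≠ b ∧ (a < N ∧ SActivated M x (a :: u)) ∧ (b < N ∧ SActivated M x (b :: u))) ∧
        SGammaAux N1 N0 M x (k + 1) u =
          if u.length % 2 = 0 then SMuxResult.oneStar else SMuxResult.zeroStar) := by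
  subst hN
  rw [SGammaAux]
  by_cases h : ∃! a : ℕ, a < (if u.length % 2 = 0 then N1 else N0) ∧ SActivated M x (a :: u)
  · left
    refine ⟨h.exists.choose, fun b => ⟨fun hb => h.unique hb h.exists.choose_spec, ?_⟩, dif_pos h⟩
    rintro rfl
    exact h.exists.choose_spec
  right
  rw [dif_neg h]
  by_cases h0 : ∀ a : ℕ, a < (if u.length % 2 = 0 then N1 else N0) → ¬ SActivated M x (a :: u)
  · exact Or.inl ⟨fun a ha => h0 a ha.1 ha.2, if_pos h0⟩
  right
  refine ⟨?_, if_neg h0⟩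
  push Not at h0
  obtain ⟨a, ha⟩ := h0
  by_contra hc
  refine h ⟨a, ha, fun b hb => ?_⟩
  by_contra hba
  exact hc ⟨b, a, hba, hb, ha⟩

theorem SGammaAux_value_mono (N1 N0 : ℕ) {n : ℕ} (M : List ℕ → Fin n → Fin n)
    (H : List ℕ → (Fin n → Bool) → Bool) (d : ℕ)
    (hH : ∀ u : List ℕ, u.length = d → ((∀ x, H u x = false) ∨ (∀ x, H u x = true)))
    {x y : Fin n → Bool} (hxy : x ≤ y) (k : ℕ) (u : List ℕ) (hu : u.length + k = d) :
    (SGammaAux N1 N0 M x k u).value H x ≤ (SGammaAux N1 N0 M y k u).value H y := by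
  induction k generalizing u with
  | zero =>
    rcases hH u (by simpa using hu) with h | h <;> simp [SGammaAux, SMuxResult.value, h]
  | succ k ih =>
    obtain ⟨N, hN⟩ : ∃ N, N = if u.length % 2 = 0 then N1 else N0 := ⟨_, rfl⟩
    have ih' : ∀ a, _ := fun a => ih (a :: u) (by simp only [List.length_cons]; omega)
    by_cases hp : u.length % 2 = 0
    · have hm : ∀ a, a < N ∧ SActivated M x (a :: u) → a < N ∧ SActivated M y (a :: u) :=
        fun a ha => ⟨ha.1, ha.2.mono_of_odd hxy (by simp only [List.length_cons]; omega)⟩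
      rcases SGammaAux_succ_cases N1 N0 M x k u hN with
        ⟨a, ha, hx⟩ | ⟨-, hx⟩ | ⟨⟨a, b, hab, ha, hb⟩, hx⟩
      · rcases SGammaAux_succ_cases N1 N0 M y k u hN with ⟨c, hc, hy⟩ | ⟨hc, -⟩ | ⟨-, hy⟩
        · obtain rfl : a = c := (hc a).mp (hm a ((ha a).mpr rfl))
          rw [hx, hy]
          exact ih' a
        · exact (hc a (hm a ((ha a).mpr rfl))).elim
        · rw [hy, if_pos hp]
          exact le_top
      · rw [hx, if_pos hp]
        exact bot_le
      · rcases SGammaAux_succ_cases N1 N0 M y k u hN with ⟨c, hc, -⟩ | ⟨hc, -⟩ | ⟨-, hy⟩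
        · exact (hab (((hc a).mp (hm a ha)).trans ((hc b).mp (hm b hb)).symm)).elim
        · exact (hc a (hm a ha)).elim
        · rw [hy, if_pos hp]
          exact le_top
    · have hm : ∀ a, a < N ∧ SActivated M y (a :: u) → a < N ∧ SActivated M x (a :: u) :=
        fun a ha => ⟨ha.1, ha.2.anti_of_even hxy (by simp only [List.length_cons]; omega)⟩
      rcases SGammaAux_succ_cases N1 N0 M y k u hN with
        ⟨a, ha, hy⟩ | ⟨-, hy⟩ | ⟨⟨a, b, hab, ha, hb⟩, hy⟩
      · rcases SGammaAux_succ_cases N1 N0 M x k u hN with ⟨c, hc, hx⟩ | ⟨hc, -⟩ | ⟨-, hx⟩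
        · obtain rfl : a = c := (hc a).mp (hm a ((ha a).mpr rfl))
          rw [hx, hy]
          exact ih' a
        · exact (hc a (hm a ((ha a).mpr rfl))).elim
        · rw [hx, if_neg hp]
          exact bot_le
      · rw [hy, if_neg hp]
        exact le_top
      · rcases SGammaAux_succ_cases N1 N0 M x k u hN with ⟨c, hc, -⟩ | ⟨hc, -⟩ | ⟨-, hx⟩
        · exact (hab (((hc a).mp (hm a ha)).trans ((hc b).mp (hm b hb)).symm)).elim
        · exact (hc a (hm a ha)).elim
        · rw [hx, if_neg hp]
          exact bot_le

theorem hwt_mono {n : ℕ} : Monotone (hwt (n := n)) := by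
  intro x y hxy
  refine card_le_card fun i hi => ?_
  simp only [mem_filter, mem_univ, true_and] at hi ⊢
  have h := hxy i
  rw [hi] at h
  exact top_le_iff.mp h

theorem STalagrand_eq_value (ℓ N1 N0 : ℕ) {n : ℕ} (M : List ℕ → Fin n → Fin n)
    (H : List ℕ → (Fin n → Bool) → Bool) (x : Fin n → Bool) :
    STalagrand ℓ N1 N0 M H x =
      if 4 * hwt x < 3 * n then false
      else if 3 * n + 4 < 4 * hwt x then true
      else (SGammaAux N1 N0 M x (2 * ℓ) []).value H x := by
  unfold STalagrand
  cases SGammaAux N1 N0 M x (2 * ℓ) [] <;> rfl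

/-- if every leaf function `h_u` is constant, then the sandwiched
`(2ℓ)`-level Talagrand function (with `N1 = ⌈(4/3)^n⌉` and `N0 = 4^n`) is monotone. -/
theorem stmt17 (ℓ n : ℕ) (hℓ : 1 ≤ ℓ) (hn : 4 ≤ n) (hdvd : 4 ∣ n)
    (M : List ℕ → Fin n → Fin n) (H : List ℕ → (Fin n → Bool) → Bool)
    (hH : ∀ u : List ℕ, u.length = 2 * ℓ →
      ((∀ x, H u x = false) ∨ (∀ x, H u x = true))) :
    Monotone (STalagrand ℓ (⌈((4 : ℝ) / 3) ^ n⌉₊) (4 ^ n) M H) := by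
  intro x y hxy
  have hw := hwt_mono hxy
  rw [STalagrand_eq_value, STalagrand_eq_value]
  by_cases hx0 : 4 * hwt x < 3 * n
  · rw [if_pos hx0]
    exact bot_le
  by_cases hy1 : 3 * n + 4 < 4 * hwt y
  · rw [if_neg (by omega : ¬ 4 * hwt y < 3 * n), if_pos hy1]
    exact le_top
  rw [if_neg hx0, if_neg (by omega : ¬ 3 * n + 4 < 4 * hwt x),
    if_neg (by omega : ¬ 4 * hwt y < 3 * n), if_neg hy1]
  exact SGammaAux_value_mono _ _ M H (2 * ℓ) hH hxy (2 * ℓ) [] (by simp)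
end
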